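/- Let d ≥ 1 and α ∈ (0,2). For every t > 0 the function (x,v) ↦ p_t(x,v) is continuously differentiable on ℝ^d × ℝ^d, and there exists a constant C = C(d,α) > 0 such that for all t > 0 and all (x,v) ∈ ℝ^d × ℝ^d, |∇_x p_t(x,v)| ≤ C · t^{−(2d+1)/α − 1 − d} · 𝒩_{d+α}(t^{−1/α−1} x, t^{−1/α} v) and |∇_v p_t(x,v)| ≤ C · t^{−(2d+1)/α − d} · 𝒩_{d+α}(t^{−1/α−1} x, t^{−1/α} v). -/

import Mathlib

open MeasureTheory Real RealInnerProductSpace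

/-- The kinetic heat kernel of `Δ_v^{α/2} + v·∇_x`, via its Fourier integral. -/
noncomputable def kinHeat (d : ℕ) (α t : ℝ) (x v : EuclideanSpace ℝ (Fin d)) : ℝ :=
  (2 * π) ^ (-(2 * (d : ℝ))) *
    ∫ w : EuclideanSpace ℝ (Fin d) × EuclideanSpace ℝ (Fin d),
      Real.cos (⟪x, w.1⟫ + ⟪v, w.2⟫) *
        Real.exp (-∫ s in (0 : ℝ)..t, ‖s • w.1 + w.2‖ ^ α)

/-- The function `𝒩_β`. -/
noncomputable def kinN (d : ℕ) (β : ℝ) (x v : EuclideanSpace ℝ (Fin d)) : ℝ :=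
  (1 + Real.sqrt (‖x‖ ^ 2 + ‖v‖ ^ 2)) ^ (-(1 + β)) *
    (1 + ⨅ s : Set.Icc (0 : ℝ) 1, ‖x - (s : ℝ) • v‖) ^ (1 - β)

/-- The polynomial weight `(1 + ‖x‖) ^ (-β)`. -/
noncomputable def polyWeight {F : Type*} [NormedAddCommGroup F] (β : ℝ) (x : F) : ℝ :=
  (1 + ‖x‖) ^ (-β)

section PolyWeight

variable {F : Type*} [NormedAddCommGroup F] {β : ℝ}

lemma polyWeight_pos (β : ℝ) (x : F) : 0 < polyWeight β x := by
  unfold polyWeight; positivity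

lemma polyWeight_le_of_le {G : Type*} [NormedAddCommGroup G] (hβ : 0 ≤ β) {A : ℝ} (hA : 0 < A)
    {x : F} {y : G} (h : 1 + ‖x‖ ≤ A * (1 + ‖y‖)) :
    polyWeight β y ≤ A ^ β * polyWeight β x := by
  unfold polyWeight
  have hx : 0 < 1 + ‖x‖ := by positivity
  have hy : 0 < 1 + ‖y‖ := by positivity
  have h1 : (A * (1 + ‖y‖)) ^ (-β) ≤ (1 + ‖x‖) ^ (-β) :=
    Real.rpow_le_rpow_of_nonpos hx h (by linarith)
  rw [Real.mul_rpow hA.le hy.le, Real.rpow_neg hA.le] at h1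
  have h2 : 0 < A ^ β := by positivity
  rwa [inv_mul_le_iff₀ h2] at h1

lemma polyWeight_sub_le (hβ : 0 ≤ β) (x y : F) (hy : ‖y‖ ≤ 1) :
    polyWeight β (x - y) ≤ 2 ^ β * polyWeight β x := by
  apply polyWeight_le_of_le hβ two_pos
  have := norm_le_norm_sub_add x y
  linarith [norm_nonneg (x - y)]

lemma continuous_polyWeight (β : ℝ) : Continuous (polyWeight β : F → ℝ) := by
  unfold polyWeight
  exact (by fun_prop : Continuous fun x : F => 1 + ‖x‖).rpow_const
    fun x => Or.inl (by positivity)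

lemma polyWeight_mul_le {G : Type*} [NormedAddCommGroup G] (hβ : 0 ≤ β) (z u : F) (y : G)
    (hu : ‖u‖ ≤ ‖y‖) :
    polyWeight β y * polyWeight β (z - u) ≤
      2 ^ β * polyWeight β z * (polyWeight β y + polyWeight β (z - u)) := by
  have h0 := norm_le_norm_sub_add z u
  have hy := polyWeight_pos β y
  have hz := polyWeight_pos β z
  have hzu := polyWeight_pos β (z - u)
  have h2 : (0 : ℝ) < 2 ^ β := by positivity
  rcases le_total (‖z‖ / 2) ‖y‖ with h | h
  · have : polyWeight β y ≤ 2 ^ β * polyWeight β z :=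
      polyWeight_le_of_le hβ two_pos (by linarith)
    calc _ ≤ 2 ^ β * polyWeight β z * polyWeight β (z - u) := by gcongr
      _ ≤ _ := by gcongr; linarith
  · have : polyWeight β (z - u) ≤ 2 ^ β * polyWeight β z :=
      polyWeight_le_of_le hβ two_pos (by linarith)
    calc _ ≤ polyWeight β y * (2 ^ β * polyWeight β z) := by gcongr
      _ = 2 ^ β * polyWeight β z * polyWeight β y := by ring
      _ ≤ _ := by gcongr; linarith

lemma polyWeight_mul_add_smul_le [NormedSpace ℝ F] {n : ℕ} (hβ : (n : ℝ) ≤ β) (a u : F) {τ : ℝ}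
    (hτ : |τ| ≤ 1) :
    polyWeight β u * polyWeight β (a + τ • u) ≤
      4 ^ β * polyWeight β a * (polyWeight β u + |τ| ^ n * polyWeight β (a + τ • u)) := by
  have hβ0 : 0 ≤ β := (Nat.cast_nonneg n).trans hβ
  have hu := polyWeight_pos β u
  have ha := polyWeight_pos β a
  have hau := polyWeight_pos β (a + τ • u)
  have hτ0 := abs_nonneg τ
  have hmono : polyWeight β u ≤ polyWeight β u + |τ| ^ n * polyWeight β (a + τ • u) := by
    have : 0 ≤ |τ| ^ n * polyWeight β (a + τ • u) := by positivity
    linarith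
  have hns : ‖τ • u‖ = |τ| * ‖u‖ := by rw [norm_smul, Real.norm_eq_abs]
  have htri : ‖a‖ ≤ ‖a + τ • u‖ + ‖τ • u‖ := by
    simpa using norm_sub_le (a + τ • u) (τ • u)
  rcases le_total ‖τ • u‖ (‖a‖ / 2) with h | h
  · have : polyWeight β (a + τ • u) ≤ 4 ^ β * polyWeight β a :=
      polyWeight_le_of_le hβ0 (by norm_num) (by linarith [norm_nonneg a])
    calc _ ≤ polyWeight β u * (4 ^ β * polyWeight β a) := by gcongr
      _ = 4 ^ β * polyWeight β a * polyWeight β u := by ring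
      _ ≤ _ := by gcongr
  rcases le_total ‖a‖ 1 with h1 | h1
  · have : polyWeight β (a + τ • u) ≤ 4 ^ β * polyWeight β a :=
      polyWeight_le_of_le hβ0 (by norm_num) (by linarith [norm_nonneg (a + τ • u)])
    calc _ ≤ polyWeight β u * (4 ^ β * polyWeight β a) := by gcongr
      _ = 4 ^ β * polyWeight β a * polyWeight β u := by ring
      _ ≤ _ := by gcongr
  · have hτpos : 0 < |τ| := by
      rcases hτ0.eq_or_lt with h2 | h2
      · rw [hns, ← h2] at h; linarith
      · exact h2
    have : polyWeight β u ≤ (4 * |τ|) ^ β * polyWeight β a :=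
      polyWeight_le_of_le hβ0 (by positivity) (by nlinarith)
    have h3 : (4 * |τ|) ^ β ≤ 4 ^ β * |τ| ^ n := by
      rw [Real.mul_rpow (by norm_num) hτ0, ← Real.rpow_natCast]
      gcongr 4 ^ β * ?_
      exact Real.rpow_le_rpow_of_exponent_ge hτpos hτ hβ
    calc _ ≤ (4 ^ β * |τ| ^ n * polyWeight β a) * polyWeight β (a + τ • u) := by
          gcongr; exact this.trans (by gcongr)
      _ = 4 ^ β * polyWeight β a * (|τ| ^ n * polyWeight β (a + τ • u)) := by ring
      _ ≤ _ := by gcongr; linarith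

lemma norm_smul_prodMk_le {E : Type*} [NormedAddCommGroup E] [NormedSpace ℝ E] {s : ℝ}
    (hs : s ∈ Set.Icc (0 : ℝ) 1) (y : E) :
    ‖((s • y, y) : E × E)‖ ≤ ‖y‖ := by
  rw [Prod.norm_def]
  refine max_le ?_ le_rfl
  rw [norm_smul, Real.norm_of_nonneg hs.1]
  exact mul_le_of_le_one_left (norm_nonneg y) hs.2

end PolyWeight

section LIntegral

variable {E : Type*} [NormedAddCommGroup E] [InnerProductSpace ℝ E] [FiniteDimensional ℝ E]
  [MeasurableSpace E] [BorelSpace E] {β : ℝ}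

open scoped ENNReal
open Module Set

/-- The weight `polyWeight`, with values in `ℝ≥0∞`. -/
noncomputable def ePolyWeight {F : Type*} [NormedAddCommGroup F] (β : ℝ) (x : F) : ℝ≥0∞ :=
  ENNReal.ofReal (polyWeight β x)

lemma continuous_ePolyWeight {F : Type*} [NormedAddCommGroup F] (β : ℝ) :
    Continuous (ePolyWeight β : F → ℝ≥0∞) :=
  ENNReal.continuous_ofReal.comp (continuous_polyWeight β)

lemma lintegral_ePolyWeight_lt_top (hβ : (finrank ℝ E : ℝ) < β) :
    ∫⁻ y : E, ePolyWeight β y < ∞ := by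
  have := (integrable_one_add_norm (E := E) (μ := volume) hβ)
  simpa [ePolyWeight, polyWeight] using! this.lintegral_lt_top

lemma abs_pow_mul_lintegral_add_smul_le (hE : finrank ℝ E ≠ 0) (f : E → ℝ≥0∞) (hf : Measurable f)
    (a : E) (τ : ℝ) :
    ENNReal.ofReal (|τ| ^ finrank ℝ E) * ∫⁻ u, f (a + τ • u) ≤ ∫⁻ u, f u := by
  rcases eq_or_ne τ 0 with rfl | hτ
  · simp [hE]
  have h1 : ∫⁻ u, f (a + τ • u) =
      ∫⁻ u, f (a + u) ∂(Measure.map (τ • · : E → E) volume) := by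
    rw [lintegral_map (by fun_prop) (by fun_prop)]
  rw [h1, Measure.map_addHaar_smul _ hτ, lintegral_smul_measure, lintegral_add_left_eq_self,
    smul_eq_mul, ← mul_assoc, ← ENNReal.ofReal_mul (by positivity), abs_inv, abs_pow,
    mul_inv_cancel₀ (by positivity)]
  simp

lemma lintegral_ePolyWeight_mul_le (hE : finrank ℝ E ≠ 0) (hβ : (finrank ℝ E : ℝ) ≤ β)
    (a : E) {τ : ℝ} (hτ : |τ| ≤ 1) :
    ∫⁻ u : E, ePolyWeight β u * ePolyWeight β (a + τ • u) ≤
      ENNReal.ofReal (4 ^ β) * (2 * ∫⁻ y : E, ePolyWeight β y) * ePolyWeight β a := by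
  have hm : Measurable (ePolyWeight β : E → ℝ≥0∞) := (continuous_ePolyWeight β).measurable
  calc _ ≤ ∫⁻ u : E, ENNReal.ofReal (4 ^ β) * ePolyWeight β a * (ePolyWeight β u +
        ENNReal.ofReal (|τ| ^ finrank ℝ E) * ePolyWeight β (a + τ • u)) := by
        apply lintegral_mono
        intro u
        have h := polyWeight_mul_add_smul_le hβ a u hτ
        have h1 := (polyWeight_pos β a).le
        have h2 := (polyWeight_pos β u).le
        have h3 := (polyWeight_pos β (a + τ • u)).le
        simp only [ePolyWeight]
        rw [← ENNReal.ofReal_mul h2, ← ENNReal.ofReal_mul (by positivity),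
          ← ENNReal.ofReal_mul (by positivity), ← ENNReal.ofReal_add h2 (by positivity),
          ← ENNReal.ofReal_mul (by positivity)]
        exact ENNReal.ofReal_le_ofReal h
    _ = ENNReal.ofReal (4 ^ β) * ePolyWeight β a * ((∫⁻ u : E, ePolyWeight β u) +
        ENNReal.ofReal (|τ| ^ finrank ℝ E) * ∫⁻ u : E, ePolyWeight β (a + τ • u)) := by
        rw [lintegral_const_mul _ (by fun_prop), lintegral_add_left hm,
          lintegral_const_mul _ (by fun_prop)]
    _ ≤ ENNReal.ofReal (4 ^ β) * ePolyWeight β a *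
        ((∫⁻ u : E, ePolyWeight β u) + ∫⁻ u : E, ePolyWeight β u) := by
        gcongr
        exact abs_pow_mul_lintegral_add_smul_le hE _ hm a τ
    _ = _ := by ring

/-- An explicit majorant of the kinetic heat kernel at time one. -/
noncomputable def kinMajorant (β : ℝ) (z : E × E) : ℝ≥0∞ :=
  ePolyWeight β z * ∫⁻ r in Icc (0 : ℝ) 1, ePolyWeight β (z.1 - r • z.2)

lemma measurable_kinMajorant (β : ℝ) : Measurable (kinMajorant β : E × E → ℝ≥0∞) := by
  unfold kinMajorant
  refine (continuous_ePolyWeight β).measurable.mul ?_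
  refine Measurable.lintegral_prod_right' (f := fun p : (E × E) × ℝ =>
    ePolyWeight β (p.1.1 - p.2 • p.1.2)) ?_
  exact (continuous_ePolyWeight β).measurable.comp (by fun_prop)

lemma lintegral_ePolyWeight_mul_kinMajorant_le (hE : finrank ℝ E ≠ 0)
    (hβ : (finrank ℝ E : ℝ) ≤ β) (z : E × E) :
    ∫⁻ s in Icc (0 : ℝ) 1, ∫⁻ y : E, ePolyWeight β y * kinMajorant β (z - (s • y, y)) ≤
      ENNReal.ofReal (2 ^ β) * 2 * (ENNReal.ofReal (4 ^ β) * (2 * ∫⁻ y : E, ePolyWeight β y)) *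
        kinMajorant β z := by
  have hβ0 : 0 ≤ β := (Nat.cast_nonneg _).trans hβ
  obtain ⟨x, v⟩ := z
  set C := ENNReal.ofReal (4 ^ β) * (2 * ∫⁻ y : E, ePolyWeight β y) with hC
  set J := ∫⁻ r in Icc (0 : ℝ) 1, ePolyWeight β (x - r • v) with hJ
  have hc := continuous_ePolyWeight (F := E) β
  have hm : Measurable (ePolyWeight β : E → ℝ≥0∞) := hc.measurable
  have hpt : ∀ s ∈ Icc (0 : ℝ) 1, ∀ y : E,
      ePolyWeight β y * kinMajorant β ((x, v) - (s • y, y)) ≤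
        ENNReal.ofReal (2 ^ β) * ePolyWeight β (x, v) *
        ∫⁻ r in Icc (0 : ℝ) 1, (ePolyWeight β y * ePolyWeight β ((x - r • v) + (r - s) • y) +
          ePolyWeight β (v - y) * ePolyWeight β ((x - s • v) + (s - r) • (v - y))) := by
    intro s hs y
    have h1 : ePolyWeight β y * ePolyWeight β ((x, v) - (s • y, y)) ≤
        ENNReal.ofReal (2 ^ β) * ePolyWeight β (x, v) *
          (ePolyWeight β y + ePolyWeight β (v - y)) := by
      have h := polyWeight_mul_le hβ0 ((x, v) : E × E) (s • y, y) y (norm_smul_prodMk_le hs y)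
      have h2 : polyWeight β (((x, v) : E × E) - (s • y, y)) ≤ polyWeight β (v - y) := by
        have := polyWeight_le_of_le (x := v - y) (y := ((x, v) : E × E) - (s • y, y)) hβ0 one_pos
          (by
            rw [one_mul]
            gcongr
            exact norm_snd_le (((x, v) : E × E) - (s • y, y)))
        simpa using this
      have p1 := (polyWeight_pos β ((x, v) : E × E)).le
      have p2 := (polyWeight_pos β y).le
      have p3 := (polyWeight_pos β (v - y)).le
      simp only [ePolyWeight]
      rw [← ENNReal.ofReal_mul p2, ← ENNReal.ofReal_mul (by positivity),
          ← ENNReal.ofReal_add p2 p3, ← ENNReal.ofReal_mul (by positivity)]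
      refine ENNReal.ofReal_le_ofReal (h.trans ?_)
      gcongr
    calc _ = (ePolyWeight β y * ePolyWeight β ((x, v) - (s • y, y))) *
          ∫⁻ r in Icc (0 : ℝ) 1, ePolyWeight β ((x - s • y) - r • (v - y)) := by
          simp only [kinMajorant, mul_assoc, Prod.fst_sub, Prod.snd_sub]
      _ ≤ (ENNReal.ofReal (2 ^ β) * ePolyWeight β (x, v) *
          (ePolyWeight β y + ePolyWeight β (v - y))) *
          ∫⁻ r in Icc (0 : ℝ) 1, ePolyWeight β ((x - s • y) - r • (v - y)) := by gcongr
      _ = _ := by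
          rw [mul_assoc, ← lintegral_const_mul _ (by fun_prop)]
          congr 1
          refine lintegral_congr fun r => ?_
          have e1 : (x - r • v) + (r - s) • y = (x - s • y) - r • (v - y) := by module
          have e2 : (x - s • v) + (s - r) • (v - y) = (x - s • y) - r • (v - y) := by module
          rw [e1, e2, add_mul]
  have hτ : ∀ s ∈ Icc (0 : ℝ) 1, ∀ r ∈ Icc (0 : ℝ) 1, |r - s| ≤ 1 := by
    intro s hs r hr
    rw [abs_le]; constructor <;> linarith [hs.1, hs.2, hr.1, hr.2]
  have hin : ∀ s ∈ Icc (0 : ℝ) 1,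
      ∫⁻ y : E, ePolyWeight β y * kinMajorant β ((x, v) - (s • y, y)) ≤
        ENNReal.ofReal (2 ^ β) * ePolyWeight β (x, v) * (C * J + C * ePolyWeight β (x - s • v)) := by
    intro s hs
    refine (lintegral_mono (hpt s hs)).trans ?_
    rw [lintegral_const_mul']
    · gcongr
      rw [lintegral_lintegral_swap (by
        apply Measurable.aemeasurable
        fun_prop)]
      calc _ ≤ ∫⁻ r in Icc (0 : ℝ) 1, (C * ePolyWeight β (x - r • v) +
            C * ePolyWeight β (x - s • v)) := by
            refine setLIntegral_mono (by fun_prop) fun r hr => ?_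
            rw [lintegral_add_left (by fun_prop)]
            gcongr
            · exact lintegral_ePolyWeight_mul_le hE hβ _ (hτ s hs r hr)
            · rw [lintegral_sub_left_eq_self
                (fun u => ePolyWeight β u * ePolyWeight β ((x - s • v) + (s - r) • u)) v]
              exact lintegral_ePolyWeight_mul_le hE hβ _ (hτ r hr s hs)
        _ = _ := by
            rw [lintegral_add_right _ (by fun_prop), lintegral_const_mul _ (by fun_prop)]
            simp [hJ]
    · exact ENNReal.mul_ne_top (by simp) (by simp [ePolyWeight])
  calc _ ≤ ∫⁻ s in Icc (0 : ℝ) 1, ENNReal.ofReal (2 ^ β) * ePolyWeight β (x, v) *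
        (C * J + C * ePolyWeight β (x - s • v)) :=
        setLIntegral_mono (by fun_prop) hin
    _ = ENNReal.ofReal (2 ^ β) * ePolyWeight β (x, v) * (C * J + C * J) := by
        rw [lintegral_const_mul _ (by fun_prop), lintegral_add_left (by fun_prop),
          lintegral_const_mul C (f := fun s : ℝ => ePolyWeight β (x - s • v)) (by fun_prop)]
        simp [hJ]
    _ = _ := by
        simp only [kinMajorant, hJ]
        ring

/-- The Lévy measure on phase space induced by jumps of the velocity with intensity `k`. -/
noncomputable def kinJumpMeasure (k : E → ℝ≥0∞) : Measure (E × E) :=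
  Measure.map (fun p : ℝ × E => (p.1 • p.2, p.2))
    ((volume.restrict (Icc (0 : ℝ) 1)).prod (volume.withDensity k))

lemma lintegral_kinJumpMeasure {k : E → ℝ≥0∞} (hk : Measurable k) (hk' : ∫⁻ y, k y ≠ ∞)
    {f : E × E → ℝ≥0∞} (hf : Measurable f) :
    ∫⁻ z, f z ∂(kinJumpMeasure k) =
      ∫⁻ s in Icc (0 : ℝ) 1, ∫⁻ y : E, k y * f (s • y, y) := by
  have := isFiniteMeasure_withDensity hk'
  rw [kinJumpMeasure, lintegral_map hf (by fun_prop), lintegral_prod _ (by fun_prop)]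
  refine lintegral_congr fun s => ?_
  rw [lintegral_withDensity_eq_lintegral_mul _ hk (by fun_prop)]
  rfl

lemma isFiniteMeasure_kinJumpMeasure {k : E → ℝ≥0∞} (hk' : ∫⁻ y, k y ≠ ∞) :
    IsFiniteMeasure (kinJumpMeasure k) := by
  have := isFiniteMeasure_withDensity hk'
  unfold kinJumpMeasure
  infer_instance

lemma kinMajorant_sub_le (hβ : 0 ≤ β) (z : E × E) {s : ℝ} (hs : s ∈ Icc (0 : ℝ) 1) {y : E}
    (hy : ‖y‖ ≤ 1) :
    kinMajorant β (z - (s • y, y)) ≤ ENNReal.ofReal (2 ^ β * 2 ^ β) * kinMajorant β z := by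
  have hc := continuous_ePolyWeight (F := E) β
  have hm : Measurable (ePolyWeight β : E → ℝ≥0∞) := hc.measurable
  unfold kinMajorant
  rw [ENNReal.ofReal_mul (by positivity), mul_mul_mul_comm]
  refine mul_le_mul' ?_ ?_
  · unfold ePolyWeight
    rw [← ENNReal.ofReal_mul (by positivity)]
    exact ENNReal.ofReal_le_ofReal
      (polyWeight_sub_le hβ _ _ ((norm_smul_prodMk_le hs y).trans hy))
  · rw [← lintegral_const_mul _ (by fun_prop)]
    refine setLIntegral_mono (by fun_prop) fun r hr => ?_
    unfold ePolyWeight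
    rw [← ENNReal.ofReal_mul (by positivity)]
    refine ENNReal.ofReal_le_ofReal ?_
    have e : (z - (s • y, y)).1 - r • (z - (s • y, y)).2 = (z.1 - r • z.2) - (s - r) • y := by
      simp only [Prod.fst_sub, Prod.snd_sub]
      module
    rw [e]
    apply polyWeight_sub_le hβ
    rw [norm_smul, Real.norm_eq_abs]
    have : |s - r| ≤ 1 := by
      rw [abs_le]; constructor <;> linarith [hs.1, hs.2, hr.1, hr.2]
    nlinarith [norm_nonneg y, abs_nonneg (s - r)]

/-- The kinetic majorant is a supersolution for convolution with the jump measure. -/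
lemma lintegral_kinMajorant_sub_le (hE : finrank ℝ E ≠ 0) (hβ : (finrank ℝ E : ℝ) ≤ β)
    {k : E → ℝ≥0∞} (hk : Measurable k) (hk' : ∫⁻ y, k y ≠ ∞) {A : ℝ≥0∞}
    (hA : ∀ y, 1 ≤ ‖y‖ → k y ≤ A * ePolyWeight β y) (z : E × E) :
    ∫⁻ z', kinMajorant β (z - z') ∂(kinJumpMeasure k) ≤
      (ENNReal.ofReal (2 ^ β * 2 ^ β) * (∫⁻ y, k y) + A * (ENNReal.ofReal (2 ^ β) * 2 *
        (ENNReal.ofReal (4 ^ β) * (2 * ∫⁻ y : E, ePolyWeight β y)))) * kinMajorant β z := by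
  have hβ0 : 0 ≤ β := (Nat.cast_nonneg _).trans hβ
  have hM := measurable_kinMajorant (E := E) β
  have hm : Measurable (ePolyWeight β : E → ℝ≥0∞) := (continuous_ePolyWeight β).measurable
  rw [lintegral_kinJumpMeasure hk hk' (by fun_prop)]
  calc _ ≤ ∫⁻ s in Icc (0 : ℝ) 1, ((∫⁻ y : E, k y) * (ENNReal.ofReal (2 ^ β * 2 ^ β) *
          kinMajorant β z) +
          A * ∫⁻ y : E, ePolyWeight β y * kinMajorant β (z - (s • y, y))) := by
        refine setLIntegral_mono (by fun_prop) fun s hs => ?_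
        rw [← lintegral_mul_const _ hk, ← lintegral_const_mul _ (by fun_prop),
          ← lintegral_add_left (by fun_prop)]
        refine lintegral_mono fun y => ?_
        rcases le_total ‖y‖ 1 with h | h
        · refine le_add_right ?_
          gcongr
          exact kinMajorant_sub_le hβ0 z hs h
        · refine le_add_left ?_
          rw [← mul_assoc]
          gcongr
          exact hA y h
    _ = (∫⁻ y : E, k y) * (ENNReal.ofReal (2 ^ β * 2 ^ β) * kinMajorant β z) +
          A * ∫⁻ s in Icc (0 : ℝ) 1, ∫⁻ y : E, ePolyWeight β y * kinMajorant β (z - (s • y, y)) := by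
        rw [lintegral_add_left (by fun_prop), lintegral_const_mul A (by fun_prop)]
        simp
    _ ≤ _ := by
        grw [lintegral_ePolyWeight_mul_kinMajorant_le hE hβ z]
        apply le_of_eq
        ring

lemma ePolyWeight_two_mul_le_kinMajorant (hβ : 0 ≤ β) (z : E × E) :
    ePolyWeight (2 * β) z ≤ ENNReal.ofReal (2 ^ β) * kinMajorant β z := by
  have h1 : polyWeight (2 * β) z = polyWeight β z * polyWeight β z := by
    unfold polyWeight
    rw [← Real.rpow_add (by positivity)]
    ring_nf
  have h2 : ∀ r ∈ Icc (0 : ℝ) 1,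
      ePolyWeight β z ≤ ENNReal.ofReal (2 ^ β) * ePolyWeight β (z.1 - r • z.2) := by
    intro r hr
    unfold ePolyWeight
    rw [← ENNReal.ofReal_mul (by positivity)]
    refine ENNReal.ofReal_le_ofReal (polyWeight_le_of_le hβ two_pos ?_)
    have h3 := norm_sub_le z.1 (r • z.2)
    rw [norm_smul, Real.norm_of_nonneg hr.1] at h3
    nlinarith [norm_fst_le z, norm_snd_le z, norm_nonneg z.2, hr.1, hr.2]
  have hm : Measurable (ePolyWeight β : E → ℝ≥0∞) := (continuous_ePolyWeight β).measurable
  calc ePolyWeight (2 * β) z = ePolyWeight β z * ∫⁻ r in Icc (0 : ℝ) 1, ePolyWeight β z := by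
        simp only [ePolyWeight]
        rw [h1, ENNReal.ofReal_mul (polyWeight_pos β z).le]
        simp
    _ ≤ ePolyWeight β z * ∫⁻ r in Icc (0 : ℝ) 1,
          ENNReal.ofReal (2 ^ β) * ePolyWeight β (z.1 - r • z.2) := by
        gcongr 1
        exact setLIntegral_mono (by fun_prop) h2
    _ = _ := by
        rw [lintegral_const_mul _ (by fun_prop), kinMajorant]
        ring

lemma lintegral_ePolyWeight_sub_smul_le (hβ : 1 < β) (x v : E) {D : ℝ} (hD0 : 0 ≤ D)
    (hD : ∀ r ∈ Icc (0 : ℝ) 1, D ≤ ‖x - r • v‖) :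
    ∫⁻ r in Icc (0 : ℝ) 1, ePolyWeight β (x - r • v) ≤
      ENNReal.ofReal (3 * (1 + 2 ^ β * ∫ r : ℝ, polyWeight β r) *
        ((1 + D) ^ (1 - β) * (1 + ‖(x, v)‖)⁻¹)) := by
  have hz : 0 < 1 + ‖(x, v)‖ := by positivity
  have hI : 0 ≤ ∫ r : ℝ, polyWeight β r := integral_nonneg fun r => (polyWeight_pos β r).le
  have h_int : Integrable (fun r : ℝ => polyWeight β r) := by
    simpa [polyWeight] using!
      integrable_one_add_norm (E := ℝ) (μ := volume) (r := β) (by simpa using hβ)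
  by_cases hcase : ∀ r ∈ Icc (0 : ℝ) 1, 1 + ‖(x, v)‖ ≤ 3 * (1 + ‖x - r • v‖)
  · calc _ ≤ ∫⁻ r in Icc (0 : ℝ) 1, ENNReal.ofReal (3 * ((1 + D) ^ (1 - β) *
          (1 + ‖(x, v)‖)⁻¹)) := by
          refine setLIntegral_mono (by fun_prop) fun r hr => ENNReal.ofReal_le_ofReal ?_
          have h1 := hcase r hr
          have h2 : 0 < 1 + ‖x - r • v‖ := by positivity
          have h3 : (1 + ‖x - r • v‖)⁻¹ ≤ 3 * (1 + ‖(x, v)‖)⁻¹ := by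
            rw [inv_le_iff_one_le_mul₀ h2]
            field_simp
            linarith
          have h4 : (1 + ‖x - r • v‖) ^ (1 - β) ≤ (1 + D) ^ (1 - β) :=
            Real.rpow_le_rpow_of_nonpos (by positivity) (by linarith [hD r hr]) (by linarith)
          calc polyWeight β (x - r • v)
              = (1 + ‖x - r • v‖) ^ (1 - β) * (1 + ‖x - r • v‖)⁻¹ := by
                rw [polyWeight, ← Real.rpow_neg_one, ← Real.rpow_add h2]
                ring_nf
            _ ≤ (1 + D) ^ (1 - β) * (3 * (1 + ‖(x, v)‖)⁻¹) := by gcongr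
            _ = _ := by ring
      _ ≤ _ := by
          simp only [lintegral_const, MeasurableSet.univ, Measure.restrict_apply, univ_inter,
            Real.volume_Icc, sub_zero, ENNReal.ofReal_one, mul_one]
          refine ENNReal.ofReal_le_ofReal ?_
          have h1 : 0 ≤ 2 ^ β * ∫ r : ℝ, polyWeight β r := by positivity
          have h2 : 0 ≤ (1 + D) ^ (1 - β) * (1 + ‖(x, v)‖)⁻¹ := by positivity
          nlinarith [mul_nonneg h1 h2]
  · push Not at hcase
    obtain ⟨r₁, hr₁, h1⟩ := hcase
    have hzv : 1 + ‖(x, v)‖ ≤ 3 * ‖v‖ := by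
      have h2 := norm_sub_norm_le x (r₁ • v)
      rw [norm_smul, Real.norm_of_nonneg hr₁.1] at h2
      have h3 : r₁ * ‖v‖ ≤ ‖v‖ := mul_le_of_le_one_left (norm_nonneg v) hr₁.2
      have h4 := norm_nonneg (x - r₁ • v)
      have h5 := norm_nonneg v
      have h6 : ‖(x, v)‖ = max ‖x‖ ‖v‖ := rfl
      rcases max_cases ‖x‖ ‖v‖ with ⟨h7, h8⟩ | ⟨h7, h8⟩ <;> rw [h6, h7] at h1 ⊢ <;> linarith
    have hv : 0 < ‖v‖ := by linarith
    set A := 1 + D with hA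
    have hApos : 0 < A := by positivity
    set r₀ := ⟪x, v⟫ / ‖v‖ ^ 2 with hr₀
    have hpt : ∀ r ∈ Icc (0 : ℝ) 1, ePolyWeight β (x - r • v) ≤
        ENNReal.ofReal (2 ^ β * A ^ (-β)) *
          ePolyWeight β (-(r₀ * ‖v‖ / A) + (‖v‖ / A) • r) := by
      intro r hr
      unfold ePolyWeight
      rw [← ENNReal.ofReal_mul (by positivity)]
      refine ENNReal.ofReal_le_ofReal ?_
      have h2 : ‖v‖ * |r - r₀| ≤ ‖x - r • v‖ := by
        have h3 := abs_real_inner_le_norm (x - r • v) v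
        have h4 : ⟪x - r • v, v⟫ = -((r - r₀) * ‖v‖ ^ 2) := by
          rw [inner_sub_left, real_inner_smul_left, real_inner_self_eq_norm_sq, hr₀]
          field_simp
          ring
        rw [h4, abs_neg, abs_mul, abs_of_nonneg (by positivity : (0 : ℝ) ≤ ‖v‖ ^ 2)] at h3
        nlinarith
      have h5 : -(r₀ * ‖v‖ / A) + (‖v‖ / A) • r = (r - r₀) * (‖v‖ / A) := by
        simp only [smul_eq_mul]; ring
      have h6 : polyWeight β (-(r₀ * ‖v‖ / A) + (‖v‖ / A) • r) =
          A ^ β * (A + ‖v‖ * |r - r₀|) ^ (-β) := by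
        rw [h5, polyWeight, Real.norm_eq_abs, abs_mul, abs_of_nonneg (by positivity : 0 ≤ ‖v‖ / A)]
        have : 1 + |r - r₀| * (‖v‖ / A) = A⁻¹ * (A + ‖v‖ * |r - r₀|) := by
          field_simp
        rw [this, Real.mul_rpow (by positivity) (by positivity), Real.rpow_neg (by positivity),
          Real.inv_rpow (by positivity), inv_inv]
      rw [h6]
      calc polyWeight β (x - r • v) ≤ (2⁻¹ * (A + ‖v‖ * |r - r₀|)) ^ (-β) := by
            refine Real.rpow_le_rpow_of_nonpos (by positivity) ?_ (by linarith)
            linarith [hD r hr, norm_nonneg (x - r • v)]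
        _ = 2 ^ β * (A + ‖v‖ * |r - r₀|) ^ (-β) := by
            rw [Real.mul_rpow (by positivity) (by positivity), Real.rpow_neg (by positivity),
              Real.inv_rpow (by positivity), inv_inv]
        _ = _ := by
            have : A ^ (-β) * A ^ β = 1 := by
              rw [← Real.rpow_add hApos]; simp
            linear_combination (-2 ^ β * (A + ‖v‖ * |r - r₀|) ^ (-β)) * this
    have hm : Measurable (ePolyWeight β : ℝ → ℝ≥0∞) := (continuous_ePolyWeight β).measurable
    have hscale := abs_pow_mul_lintegral_add_smul_le (E := ℝ) (by simp) _ hm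
      (-(r₀ * ‖v‖ / A)) (‖v‖ / A)
    have hIe : ∫⁻ u : ℝ, ePolyWeight β u = ENNReal.ofReal (∫ r : ℝ, polyWeight β r) :=
      (ofReal_integral_eq_lintegral_ofReal h_int
        (Filter.Eventually.of_forall fun r => (polyWeight_pos β r).le)).symm
    rw [finrank_self, pow_one, abs_of_nonneg (by positivity), hIe] at hscale
    calc _ ≤ ∫⁻ r in Icc (0 : ℝ) 1, ENNReal.ofReal (2 ^ β * A ^ (-β)) *
          ePolyWeight β (-(r₀ * ‖v‖ / A) + (‖v‖ / A) • r) :=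
          setLIntegral_mono (by fun_prop) hpt
      _ ≤ ENNReal.ofReal (2 ^ β * A ^ (-β)) *
          ∫⁻ r : ℝ, ePolyWeight β (-(r₀ * ‖v‖ / A) + (‖v‖ / A) • r) := by
          rw [lintegral_const_mul _ (by fun_prop)]
          gcongr 1
          exact setLIntegral_le_lintegral _ _
      _ = ENNReal.ofReal (2 ^ β * A ^ (-β) * (A / ‖v‖)) * (ENNReal.ofReal (‖v‖ / A) *
          ∫⁻ r : ℝ, ePolyWeight β (-(r₀ * ‖v‖ / A) + (‖v‖ / A) • r)) := by
          rw [← mul_assoc, ← ENNReal.ofReal_mul (by positivity)]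
          congr 2
          field_simp
      _ ≤ ENNReal.ofReal (2 ^ β * A ^ (-β) * (A / ‖v‖)) *
          ENNReal.ofReal (∫ r : ℝ, polyWeight β r) := by gcongr
      _ ≤ _ := by
          rw [← ENNReal.ofReal_mul (by positivity)]
          refine ENNReal.ofReal_le_ofReal ?_
          have h2 : A ^ (1 - β) = A ^ (-β) * A := by
            rw [← Real.rpow_add_one hApos.ne']; ring_nf
          have h3 : ‖v‖⁻¹ ≤ 3 * (1 + ‖(x, v)‖)⁻¹ := by
            rw [inv_le_iff_one_le_mul₀ hv]
            field_simp
            linarith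
          calc _ = (2 ^ β * ∫ r : ℝ, polyWeight β r) * (A ^ (-β) * A) * ‖v‖⁻¹ := by
                field_simp
            _ ≤ (1 + 2 ^ β * ∫ r : ℝ, polyWeight β r) * (A ^ (-β) * A) *
                (3 * (1 + ‖(x, v)‖)⁻¹) := by
                gcongr
                linarith
            _ = _ := by rw [h2]; ring

end LIntegral

section LevyKernel

open Module Set

/-- The Lévy density `r ^ (-1 - a)` of a stable subordinator, tempered at the origin by the
factor `1 - exp (-r)`. -/
noncomputable def temperedDensity (a r : ℝ) : ℝ := (1 - rexp (-r)) * r ^ (-1 - a)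

lemma temperedDensity_nonneg (a : ℝ) {r : ℝ} (hr : 0 ≤ r) : 0 ≤ temperedDensity a r := by
  have : rexp (-r) ≤ 1 := by simpa using hr
  exact mul_nonneg (by linarith) (by positivity)

lemma temperedDensity_pos (a : ℝ) {r : ℝ} (hr : 0 < r) : 0 < temperedDensity a r := by
  have : rexp (-r) < 1 := by simpa using hr
  exact mul_pos (by linarith) (by positivity)

lemma temperedDensity_le (a : ℝ) {r : ℝ} (hr : 0 ≤ r) : temperedDensity a r ≤ r ^ (-1 - a) :=
  mul_le_of_le_one_left (by positivity) (by linarith [exp_pos (-r)])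

@[fun_prop]
lemma measurable_temperedDensity (a : ℝ) : Measurable (temperedDensity a) := by
  unfold temperedDensity; fun_prop

lemma integrableOn_Ioi_of_le_rpow {f : ℝ → ℝ} (hf : Measurable f) {p q C : ℝ} (hp : -1 < p)
    (hq : q < -1) (h0 : ∀ r ∈ Ioc (0 : ℝ) 1, ‖f r‖ ≤ C * r ^ p)
    (h1 : ∀ r ∈ Ioi (1 : ℝ), ‖f r‖ ≤ C * r ^ q) : IntegrableOn f (Ioi 0) := by
  rw [← Ioc_union_Ioi_eq_Ioi zero_le_one]
  refine IntegrableOn.union ?_ ?_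
  · have := ((intervalIntegral.intervalIntegrable_rpow' (a := 0) (b := 1) hp).1.const_mul C)
    exact this.mono' hf.aestronglyMeasurable
      ((ae_restrict_iff' measurableSet_Ioc).2 (Filter.Eventually.of_forall h0))
  · have := (integrableOn_Ioi_rpow_of_lt hq one_pos).const_mul C
    exact this.mono' hf.aestronglyMeasurable
      ((ae_restrict_iff' measurableSet_Ioi).2 (Filter.Eventually.of_forall h1))

lemma integrableOn_temperedDensity {a : ℝ} (h0 : 0 < a) (h1 : a < 1) :
    IntegrableOn (temperedDensity a) (Ioi 0) := by
  refine integrableOn_Ioi_of_le_rpow (C := 1) (measurable_temperedDensity a) (p := -a)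
    (q := -1 - a) (by linarith) (by linarith) (fun r hr => ?_) (fun r hr => ?_)
  · rw [Real.norm_of_nonneg (temperedDensity_nonneg a hr.1.le), temperedDensity, one_mul]
    have h2 : 1 - rexp (-r) ≤ r := by linarith [add_one_le_exp (-r)]
    calc _ ≤ r * r ^ (-1 - a) := by
          have := hr.1
          gcongr
      _ = r ^ (-a) := by
          rw [← rpow_one_add' hr.1.le (by linarith)]; ring_nf
  · have : (0 : ℝ) ≤ r := by linarith [mem_Ioi.1 hr]
    rw [Real.norm_of_nonneg (temperedDensity_nonneg a this), one_mul]
    exact temperedDensity_le a this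

lemma integral_one_sub_exp_mul_rpow {a : ℝ} (h0 : 0 < a) (h1 : a < 1) {b : ℝ} (hb : 0 ≤ b) :
    IntegrableOn (fun r => (1 - rexp (-(r * b))) * r ^ (-1 - a)) (Ioi 0) ∧
    ∫ r in Ioi (0 : ℝ), (1 - rexp (-(r * b))) * r ^ (-1 - a) =
      b ^ a * ∫ r in Ioi (0 : ℝ), temperedDensity a r := by
  rcases hb.eq_or_lt with rfl | hb
  · simp [Real.zero_rpow h0.ne']
  have e : ∀ r ∈ Ioi (0 : ℝ), (1 - rexp (-(r * b))) * r ^ (-1 - a) =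
      b ^ (1 + a) * temperedDensity a (b * r) := by
    intro r hr
    rw [temperedDensity, Real.mul_rpow hb.le (mem_Ioi.1 hr).le]
    have : b ^ (1 + a) * b ^ (-1 - a) = 1 := by
      rw [← Real.rpow_add hb]; simp
    rw [mul_comm b r]
    linear_combination (-(1 - rexp (-(r * b))) * r ^ (-1 - a)) * this
  constructor
  · rw [integrableOn_congr_fun e measurableSet_Ioi]
    apply Integrable.const_mul
    have := (integrableOn_Ioi_comp_mul_left_iff (temperedDensity a) 0 hb).2
    rw [mul_zero] at this
    exact this (integrableOn_temperedDensity h0 h1)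
  · rw [setIntegral_congr_fun measurableSet_Ioi e, integral_const_mul,
      integral_comp_mul_left_Ioi _ _ hb, mul_zero, smul_eq_mul, ← mul_assoc]
    congr 1
    rw [Real.rpow_one_add' hb.le (by linarith)]
    field_simp

lemma integral_temperedDensity_mul_exp {a : ℝ} (h0 : 0 < a) (h1 : a < 1) {b : ℝ} (hb : 0 ≤ b) :
    ∫ r in Ioi (0 : ℝ), temperedDensity a r * rexp (-(r * b)) =
      ((1 + b) ^ a - b ^ a) * ∫ r in Ioi (0 : ℝ), temperedDensity a r := by
  obtain ⟨i1, e1⟩ := integral_one_sub_exp_mul_rpow h0 h1 hb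
  obtain ⟨i2, e2⟩ := integral_one_sub_exp_mul_rpow h0 h1 (b := 1 + b) (by linarith)
  rw [sub_mul, ← e1, ← e2, ← integral_sub i2 i1]
  refine integral_congr_ae (Filter.Eventually.of_forall fun r => ?_)
  have : rexp (-(r * (1 + b))) = rexp (-r) * rexp (-(r * b)) := by
    rw [← Real.exp_add]; ring_nf
  simp only [this, temperedDensity]
  ring

lemma integral_temperedDensity_pos {a : ℝ} (h0 : 0 < a) (h1 : a < 1) :
    0 < ∫ r in Ioi (0 : ℝ), temperedDensity a r := by
  rw [setIntegral_pos_iff_support_of_nonneg_ae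
    ((ae_restrict_iff' measurableSet_Ioi).2 (Filter.Eventually.of_forall
      fun r hr => temperedDensity_nonneg a (mem_Ioi.1 hr).le)) (integrableOn_temperedDensity h0 h1)]
  have : Ioi (0 : ℝ) ⊆ Function.support (temperedDensity a) ∩ Ioi 0 :=
    fun r hr => ⟨(temperedDensity_pos a hr).ne', hr⟩
  exact lt_of_lt_of_le (by simp) (measure_mono this)

lemma integrableOn_rpow_mul_exp_neg_inv {q : ℝ} (hq : 0 < q) :
    IntegrableOn (fun r => r ^ (-1 - q) * rexp (-(1 / (4 * r)))) (Ioi 0) := by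
  obtain ⟨n, hn⟩ := exists_nat_gt (1 + q)
  refine integrableOn_Ioi_of_le_rpow (C := n.factorial * 4 ^ n) (by fun_prop) (p := 0)
    (q := -1 - q) (by norm_num) (by linarith) (fun r hr => ?_) (fun r hr => ?_)
  · have hr0 := hr.1
    rw [Real.norm_of_nonneg (by positivity), Real.rpow_zero, mul_one]
    have h2 : rexp (-(1 / (4 * r))) ≤ n.factorial * (4 * r) ^ n := by
      have h3 := Real.pow_div_factorial_le_exp (1 / (4 * r)) (by positivity) n
      rw [Real.exp_neg, inv_le_comm₀ (by positivity) (by positivity)]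
      rw [one_div] at h3 ⊢
      rw [inv_pow] at h3
      refine le_trans (le_of_eq ?_) h3
      rw [mul_inv, mul_comm, div_eq_mul_inv]
    calc _ ≤ r ^ (-1 - q) * (n.factorial * (4 * r) ^ n) := by gcongr
      _ = n.factorial * 4 ^ n * (r ^ (-1 - q) * r ^ (n : ℝ)) := by
          rw [mul_pow, Real.rpow_natCast]; ring
      _ ≤ n.factorial * 4 ^ n * 1 := by
          gcongr
          rw [← Real.rpow_add hr0]
          exact Real.rpow_le_one hr0.le hr.2 (by linarith)
      _ = _ := by ring
  · have hr0 : (0 : ℝ) < r := by linarith [mem_Ioi.1 hr]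
    rw [Real.norm_of_nonneg (by positivity), mul_comm]
    gcongr
    calc rexp (-(1 / (4 * r))) ≤ 1 := by simp; positivity
      _ ≤ _ := by
        have : (1 : ℝ) ≤ n.factorial := by exact_mod_cast n.factorial_pos
        have h4 : (1 : ℝ) ≤ 4 ^ n := one_le_pow₀ (by norm_num)
        nlinarith

lemma integral_rpow_mul_exp_neg_div {q : ℝ} (hq : 0 < q) {b : ℝ} (hb : 0 < b) :
    IntegrableOn (fun r => r ^ (-1 - q) * rexp (-(b / (4 * r)))) (Ioi 0) ∧
    ∫ r in Ioi (0 : ℝ), r ^ (-1 - q) * rexp (-(b / (4 * r))) =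
      b ^ (-q) * ∫ r in Ioi (0 : ℝ), r ^ (-1 - q) * rexp (-(1 / (4 * r))) := by
  have hb' : 0 < b⁻¹ := by positivity
  have e : ∀ r ∈ Ioi (0 : ℝ), r ^ (-1 - q) * rexp (-(b / (4 * r))) =
      b ^ (-1 - q) * (fun r => r ^ (-1 - q) * rexp (-(1 / (4 * r)))) (b⁻¹ * r) := by
    intro r hr
    have hr0 := mem_Ioi.1 hr
    simp only
    rw [Real.mul_rpow hb'.le (mem_Ioi.1 hr).le, Real.inv_rpow hb.le]
    have : b ^ (-1 - q) * (b ^ (-1 - q))⁻¹ = 1 := mul_inv_cancel₀ (by positivity)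
    have h2 : 1 / (4 * (b⁻¹ * r)) = b / (4 * r) := by field_simp
    rw [h2]
    linear_combination (-(rexp (-(b / (4 * r)))) * r ^ (-1 - q)) * this
  constructor
  · rw [integrableOn_congr_fun e measurableSet_Ioi]
    apply Integrable.const_mul
    have := (integrableOn_Ioi_comp_mul_left_iff
      (fun r => r ^ (-1 - q) * rexp (-(1 / (4 * r)))) 0 hb').2
    rw [mul_zero] at this
    exact this (integrableOn_rpow_mul_exp_neg_inv hq)
  · rw [setIntegral_congr_fun measurableSet_Ioi e, integral_const_mul,
      integral_comp_mul_left_Ioi (fun r => r ^ (-1 - q) * rexp (-(1 / (4 * r)))) _ hb', mul_zero,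
        smul_eq_mul, inv_inv, ← mul_assoc]
    congr 1
    rw [← Real.rpow_add_one hb.ne']
    ring_nf

variable {E : Type*} [NormedAddCommGroup E] [InnerProductSpace ℝ E] [FiniteDimensional ℝ E]
  [MeasurableSpace E] [BorelSpace E]

lemma integrable_rexp_neg_mul_sq_norm {b : ℝ} (hb : 0 < b) :
    Integrable (fun y : E => rexp (-b * ‖y‖ ^ 2)) := by
  have := (GaussianFourier.integrable_cexp_neg_mul_sq_norm_add (V := E) (b := (b : ℂ))
    (by simpa using hb) 0 0).norm
  simpa [Complex.norm_exp, ← Complex.ofReal_pow] using this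

lemma integral_gaussian_mul_cexp {r : ℝ} (hr : 0 < r) (η : E) :
    ∫ y : E, Complex.exp (Complex.I * ⟪y, η⟫) *
      ((4 * π * r) ^ (-(finrank ℝ E : ℝ) / 2) * rexp (-(1 / (4 * r)) * ‖y‖ ^ 2) : ℝ) =
      (rexp (-(r * ‖η‖ ^ 2)) : ℝ) := by
  have h := GaussianFourier.integral_cexp_neg_mul_sq_norm_add (V := E) (b := ((1 / (4 * r) : ℝ) : ℂ))
    (by rw [Complex.ofReal_re]; positivity) Complex.I η
  have e1 : ((π : ℂ) / ((1 / (4 * r) : ℝ) : ℂ)) ^ ((finrank ℝ E : ℂ) / 2) =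
      (((4 * π * r) ^ ((finrank ℝ E : ℝ) / 2) : ℝ) : ℂ) := by
    rw [Complex.ofReal_cpow (by positivity)]
    congr 1
    · push_cast; field_simp
    · push_cast; rfl
  have e2 : Complex.exp (Complex.I ^ 2 * ‖η‖ ^ 2 / (4 * ((1 / (4 * r) : ℝ) : ℂ))) =
      (rexp (-(r * ‖η‖ ^ 2)) : ℝ) := by
    push_cast
    congr 1
    rw [Complex.I_sq]
    have : (r : ℂ) ≠ 0 := by exact_mod_cast hr.ne'
    field_simp
  rw [e1, e2] at h
  have e3 : ∀ y : E, Complex.exp (Complex.I * ⟪y, η⟫) *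
      ((4 * π * r) ^ (-(finrank ℝ E : ℝ) / 2) * rexp (-(1 / (4 * r)) * ‖y‖ ^ 2) : ℝ) =
      (((4 * π * r) ^ (-(finrank ℝ E : ℝ) / 2) : ℝ) : ℂ) *
        Complex.exp (-((1 / (4 * r) : ℝ) : ℂ) * ‖y‖ ^ 2 + Complex.I * ⟪η, y⟫) := by
    intro y
    rw [Complex.exp_add, real_inner_comm]
    push_cast
    ring
  simp_rw [e3]
  rw [integral_const_mul, h, ← mul_assoc, ← Complex.ofReal_mul, ← Real.rpow_add (by positivity)]
  simp [neg_div]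

/-- Gaussian mixture whose Fourier transform is `(1 + |η|²)^{α/2} - |η|^α`. -/
lemma exists_kernel_fourier_eq {α : ℝ} (hα : α ∈ Ioo (0 : ℝ) 2) :
    ∃ k : E → ℝ, Measurable k ∧ (∀ y, 0 ≤ k y) ∧ Integrable k ∧
      (∃ A : ℝ, 0 ≤ A ∧ ∀ y, 1 ≤ ‖y‖ → k y ≤ A * polyWeight (finrank ℝ E + α) y) ∧
      ∀ η : E, ∫ y, Complex.exp (Complex.I * ⟪y, η⟫) * (k y : ℂ) =
        (((1 + ‖η‖ ^ 2) ^ (α / 2) - ‖η‖ ^ α : ℝ) : ℂ) := by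
  have h0 : 0 < α / 2 := by linarith [hα.1]
  have h1 : α / 2 < 1 := by linarith [hα.2]
  set c := ∫ r in Ioi (0 : ℝ), temperedDensity (α / 2) r with hc
  have hcpos : 0 < c := integral_temperedDensity_pos h0 h1
  set g : ℝ → E → ℝ := fun r y => temperedDensity (α / 2) r *
    ((4 * π * r) ^ (-(finrank ℝ E : ℝ) / 2) * rexp (-(1 / (4 * r)) * ‖y‖ ^ 2)) with hg
  have hgm : Measurable (Function.uncurry g) := by
    simp only [hg, Function.uncurry_def]
    fun_prop
  have hg0 : ∀ r ∈ Ioi (0 : ℝ), ∀ y, 0 ≤ g r y := fun r hr y =>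
    mul_nonneg (temperedDensity_nonneg _ (mem_Ioi.1 hr).le)
      (mul_nonneg (Real.rpow_nonneg (by have := mem_Ioi.1 hr; positivity) _) (exp_pos _).le)
  have hgi : ∀ r ∈ Ioi (0 : ℝ), Integrable (g r) := fun r hr =>
    ((integrable_rexp_neg_mul_sq_norm (E := E)
      (by have := mem_Ioi.1 hr; positivity : 0 < 1 / (4 * r))).const_mul _).const_mul _
  have hgI : ∀ r ∈ Ioi (0 : ℝ), ∫ y, g r y = temperedDensity (α / 2) r := by
    intro r hr
    have := integral_gaussian_mul_cexp (E := E) (mem_Ioi.1 hr) 0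
    simp only [inner_zero_right, Complex.ofReal_zero, mul_zero, Complex.exp_zero, one_mul,
      norm_zero, ne_eq, OfNat.ofNat_ne_zero, not_false_eq_true, zero_pow, neg_zero,
      Real.exp_zero] at this
    rw [integral_complex_ofReal] at this
    simp only [hg]
    rw [integral_const_mul, Complex.ofReal_injective this, mul_one]
  have h_int : Integrable (Function.uncurry g) ((volume.restrict (Ioi (0 : ℝ))).prod volume) := by
    rw [integrable_prod_iff hgm.aestronglyMeasurable]
    refine ⟨(ae_restrict_iff' measurableSet_Ioi).2 (Filter.Eventually.of_forall hgi), ?_⟩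
    refine (integrableOn_congr_fun (fun r hr => ?_) measurableSet_Ioi).2
      (integrableOn_temperedDensity h0 h1)
    simp only [Function.uncurry_apply_pair]
    rw [← hgI r hr]
    exact integral_congr_ae (Filter.Eventually.of_forall fun y => Real.norm_of_nonneg (hg0 r hr y))
  refine ⟨fun y => c⁻¹ * ∫ r in Ioi (0 : ℝ), g r y, ?_, ?_, ?_, ?_, ?_⟩
  · exact (hgm.stronglyMeasurable.integral_prod_left
      (μ := volume.restrict (Ioi (0 : ℝ)))).measurable.const_mul _
  · exact fun y => mul_nonneg (by positivity)
      (setIntegral_nonneg measurableSet_Ioi fun r hr => hg0 r hr y)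
  · exact h_int.integral_prod_right.const_mul _
  · set q := ((finrank ℝ E : ℝ) + α) / 2 with hq
    have hqpos : 0 < q := by have := hα.1; positivity
    set H := ∫ r in Ioi (0 : ℝ), r ^ (-1 - q) * rexp (-(1 / (4 * r))) with hH
    have hHnn : 0 ≤ H := setIntegral_nonneg measurableSet_Ioi fun r hr => by
      have := mem_Ioi.1 hr; positivity
    refine ⟨c⁻¹ * ((4 * π) ^ (-(finrank ℝ E : ℝ) / 2) * (2 ^ ((finrank ℝ E : ℝ) + α) * H)),
      by positivity, fun y hy => ?_⟩
    have hy0 : 0 < ‖y‖ := by linarith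
    obtain ⟨i1, e1⟩ := integral_rpow_mul_exp_neg_div hqpos (b := ‖y‖ ^ 2) (by positivity)
    have hle : ∫ r in Ioi (0 : ℝ), g r y ≤ ∫ r in Ioi (0 : ℝ),
        (4 * π) ^ (-(finrank ℝ E : ℝ) / 2) * (r ^ (-1 - q) * rexp (-(‖y‖ ^ 2 / (4 * r)))) := by
      refine integral_mono_of_nonneg ((ae_restrict_iff' measurableSet_Ioi).2
        (Filter.Eventually.of_forall fun r hr => hg0 r hr y)) (i1.const_mul _)
        ((ae_restrict_iff' measurableSet_Ioi).2 (Filter.Eventually.of_forall fun r hr => ?_))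
      have hr0 := mem_Ioi.1 hr
      have e2 : -(1 / (4 * r)) * ‖y‖ ^ 2 = -(‖y‖ ^ 2 / (4 * r)) := by ring
      have e3 : r ^ (-1 - q) = r ^ (-1 - α / 2) * r ^ (-(finrank ℝ E : ℝ) / 2) := by
        rw [← Real.rpow_add hr0]; congr 1; rw [hq]; ring
      simp only [hg]
      rw [e2, e3, Real.mul_rpow (by positivity) hr0.le]
      calc _ ≤ r ^ (-1 - α / 2) * ((4 * π) ^ (-(finrank ℝ E : ℝ) / 2) *
            r ^ (-(finrank ℝ E : ℝ) / 2) * rexp (-(‖y‖ ^ 2 / (4 * r)))) := by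
            gcongr
            exact temperedDensity_le _ hr0.le
        _ = _ := by ring
    rw [integral_const_mul, e1, ← Real.rpow_natCast, ← Real.rpow_mul hy0.le] at hle
    have h3 : ‖y‖ ^ (((2 : ℕ) : ℝ) * -q) ≤
        2 ^ ((finrank ℝ E : ℝ) + α) * polyWeight ((finrank ℝ E : ℝ) + α) y := by
      have : ((2 : ℕ) : ℝ) * -q = -((finrank ℝ E : ℝ) + α) := by rw [hq]; push_cast; ring
      rw [this, polyWeight]
      have h4 : (0:ℝ) ≤ (finrank ℝ E : ℝ) + α := by have := hα.1; positivity
      calc ‖y‖ ^ (-((finrank ℝ E : ℝ) + α)) ≤ (2⁻¹ * (1 + ‖y‖)) ^ (-((finrank ℝ E : ℝ) + α)) :=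
            Real.rpow_le_rpow_of_nonpos (by positivity) (by linarith) (by linarith)
        _ = _ := by
            rw [Real.mul_rpow (by positivity) (by positivity), Real.inv_rpow (by positivity),
              Real.rpow_neg (by positivity), inv_inv]
    simp only
    calc _ ≤ c⁻¹ * ((4 * π) ^ (-(finrank ℝ E : ℝ) / 2) *
          ((2 ^ ((finrank ℝ E : ℝ) + α) * polyWeight ((finrank ℝ E : ℝ) + α) y) * H)) :=
          mul_le_mul_of_nonneg_left (hle.trans (mul_le_mul_of_nonneg_left
            (mul_le_mul_of_nonneg_right h3 hHnn) (by positivity))) (by positivity)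
      _ = _ := by ring
  · intro η
    have hsw : ∫ y, ∫ r in Ioi (0 : ℝ), Complex.exp (Complex.I * ⟪y, η⟫) * (g r y : ℂ) =
        ∫ r in Ioi (0 : ℝ), ∫ y, Complex.exp (Complex.I * ⟪y, η⟫) * (g r y : ℂ) := by
      refine (integral_integral_swap (f := fun (r : ℝ) (y : E) =>
        Complex.exp (Complex.I * ⟪y, η⟫) * (g r y : ℂ)) ?_).symm
      refine Integrable.bdd_mul (c := 1) h_int.ofReal ?_ (Filter.Eventually.of_forall fun p => ?_)
      · exact (by fun_prop : Continuous fun p : ℝ × E =>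
          Complex.exp (Complex.I * ⟪p.2, η⟫)).aestronglyMeasurable
      · rw [mul_comm, Complex.norm_exp_ofReal_mul_I]
    have hin : ∀ r ∈ Ioi (0 : ℝ), ∫ y, Complex.exp (Complex.I * ⟪y, η⟫) * (g r y : ℂ) =
        ((temperedDensity (α / 2) r * rexp (-(r * ‖η‖ ^ 2)) : ℝ) : ℂ) := by
      intro r hr
      rw [Complex.ofReal_mul, ← integral_gaussian_mul_cexp (mem_Ioi.1 hr) η, ← integral_const_mul]
      refine integral_congr_ae (Filter.Eventually.of_forall fun y => ?_)
      simp only [hg]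
      push_cast
      ring
    have e1 : ∀ y, Complex.exp (Complex.I * ⟪y, η⟫) *
        ((c⁻¹ * ∫ r in Ioi (0 : ℝ), g r y : ℝ) : ℂ) =
        ((c⁻¹ : ℝ) : ℂ) * ∫ r in Ioi (0 : ℝ), Complex.exp (Complex.I * ⟪y, η⟫) * (g r y : ℂ) := by
      intro y
      rw [integral_const_mul, integral_complex_ofReal]
      push_cast
      ring
    simp only [e1]
    rw [integral_const_mul, hsw, setIntegral_congr_fun measurableSet_Ioi hin,
      integral_complex_ofReal, integral_temperedDensity_mul_exp h0 h1 (by positivity),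
      ← Complex.ofReal_mul, ← hc, ← Real.rpow_natCast ‖η‖ 2, ← Real.rpow_mul (norm_nonneg _)]
    congr 1
    rw [show ((2 : ℕ) : ℝ) * (α / 2) = α by push_cast; ring]
    field_simp

end LevyKernel

section FourierExp

open scoped ENNReal FourierTransform
open VectorFourier

variable {V G : Type*} [NormedAddCommGroup V] [NormedSpace ℝ V] [MeasurableSpace V] [BorelSpace V]
  [SecondCountableTopology V] [NormedAddCommGroup G] [NormedSpace ℂ G]

/-- The characteristic function of `ν` with respect to the pairing `L`. -/
noncomputable def pairingCharFun (ν : Measure V) (L : V →L[ℝ] V →L[ℝ] ℝ) (w : V) : ℂ :=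
  ∫ z, (𝐞 (L w z) : ℂ) ∂ν

lemma continuous_pairing (L : V →L[ℝ] V →L[ℝ] ℝ) :
    Continuous fun p : V × V => L p.1 p.2 := by
  fun_prop

lemma norm_pairingCharFun_le (ν : Measure V) [IsFiniteMeasure ν] (L : V →L[ℝ] V →L[ℝ] ℝ) (w : V) :
    ‖pairingCharFun ν L w‖ ≤ ν.real Set.univ := by
  refine (norm_integral_le_of_norm_le_const (C := 1)
    (Filter.Eventually.of_forall fun z => (Circle.norm_coe _).le)).trans (by simp)

lemma continuous_pairingCharFun (ν : Measure V) [IsFiniteMeasure ν] (L : V →L[ℝ] V →L[ℝ] ℝ) :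
    Continuous (pairingCharFun ν L) := by
  have h (w : V) : Continuous fun z => (𝐞 (L w z) : ℂ) :=
    Continuous.comp (by fun_prop : Continuous fun u : Circle => (u : ℂ))
      (Real.continuous_fourierChar.comp (L w).continuous)
  refine continuous_of_dominated (bound := fun _ => 1) (fun w => (h w).aestronglyMeasurable)
    (fun w => Filter.Eventually.of_forall fun z => (Circle.norm_coe _).le) (integrable_const 1)
    (Filter.Eventually.of_forall fun z => ?_)
  exact Continuous.comp (by fun_prop : Continuous fun u : Circle => (u : ℂ))
    (Real.continuous_fourierChar.comp
    ((continuous_pairing L).comp (by fun_prop : Continuous fun w : V => (w, z))))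

lemma integrable_pairingCharFun_pow_smul {μ : Measure V} {f : V → G}
    (hf : Integrable f μ) (ν : Measure V) [IsFiniteMeasure ν] (L : V →L[ℝ] V →L[ℝ] ℝ) (n : ℕ) :
    Integrable (fun w => pairingCharFun ν L w ^ n • f w) μ := by
  refine hf.bdd_smul (ν.real Set.univ ^ n)
    ((continuous_pairingCharFun ν L).pow n).aestronglyMeasurable
    (Filter.Eventually.of_forall fun w => ?_)
  rw [norm_pow]
  gcongr
  exact norm_pairingCharFun_le ν L w

variable [CompleteSpace G]

/-- Multiplication by a characteristic function becomes convolution under the Fourier integral. -/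
lemma fourierIntegral_pairingCharFun_smul {μ : Measure V} [SFinite μ] {f : V → G}
    (hf : Integrable f μ) (ν : Measure V) [IsFiniteMeasure ν] (L : V →L[ℝ] V →L[ℝ] ℝ) (z : V) :
    fourierIntegral 𝐞 μ L.toLinearMap₁₂ (fun w => pairingCharFun ν L w • f w) z =
      ∫ z', fourierIntegral 𝐞 μ L.toLinearMap₁₂ f (z - z') ∂ν := by
  simp only [fourierIntegral]
  have h_int : Integrable (fun p : V × V => 𝐞 (-(L p.1 (z - p.2))) • f p.1) (μ.prod ν) := by
    simp only [Circle.smul_def]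
    refine (hf.comp_fst ν).bdd_smul (φ := fun p : V × V => ((𝐞 (-(L p.1 (z - p.2))) : Circle) : ℂ))
      1 ?_ (Filter.Eventually.of_forall fun p => (Circle.norm_coe _).le)
    have h2 : Continuous fun p : V × V => -(L p.1 (z - p.2)) :=
      ((continuous_pairing L).comp
        (by fun_prop : Continuous fun p : V × V => (p.1, z - p.2))).neg
    exact (Continuous.comp (by fun_prop : Continuous fun u : Circle => (u : ℂ))
      (Real.continuous_fourierChar.comp h2)).aestronglyMeasurable
  have h1 := integral_integral_swap (f := fun w z' : V => 𝐞 (-(L w (z - z'))) • f w) h_int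
  refine Eq.trans ?_ h1
  refine integral_congr_ae (Filter.Eventually.of_forall fun w => ?_)
  simp only [pairingCharFun, ContinuousLinearMap.toLinearMap₁₂_apply, Circle.smul_def]
  rw [smul_smul, ← integral_const_mul, ← integral_smul_const]
  refine integral_congr_ae (Filter.Eventually.of_forall fun z' => ?_)
  simp only
  rw [← Circle.coe_mul, ← AddChar.map_add_eq_mul, map_sub]
  congr 4
  change -(L w z) + L w z' = -(L w z - L w z')
  ring

/-- A pointwise bound on a Fourier integral by a supersolution for convolution with `ν` is
preserved under multiplication by powers of the characteristic function of `ν`. -/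
lemma enorm_fourierIntegral_pairingCharFun_pow_smul_le {μ : Measure V} [SFinite μ] {f : V → G}
    (hf : Integrable f μ) (ν : Measure V) [IsFiniteMeasure ν] (L : V →L[ℝ] V →L[ℝ] ℝ)
    {M : V → ℝ≥0∞} (hM : Measurable M) {κ A : ℝ≥0∞}
    (hν : ∀ z, ∫⁻ z', M (z - z') ∂ν ≤ κ * M z)
    (hA : ∀ z, ‖fourierIntegral 𝐞 μ L.toLinearMap₁₂ f z‖ₑ ≤ A * M z) (n : ℕ) (z : V) :
    ‖fourierIntegral 𝐞 μ L.toLinearMap₁₂ (fun w => pairingCharFun ν L w ^ n • f w) z‖ₑ ≤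
      A * κ ^ n * M z := by
  induction n generalizing z with
  | zero => simpa using hA z
  | succ n ih =>
    simp only [pow_succ', mul_smul]
    rw [fourierIntegral_pairingCharFun_smul (integrable_pairingCharFun_pow_smul hf ν L n) ν L z]
    calc _ ≤ ∫⁻ z', A * κ ^ n * M (z - z') ∂ν :=
          (enorm_integral_le_lintegral_enorm _).trans (lintegral_mono fun z' => ih (z - z'))
      _ ≤ A * κ ^ n * (κ * M z) := by
          rw [lintegral_const_mul _ (by fun_prop)]
          gcongr
          exact hν z
      _ = _ := by ring

lemma enorm_fourierIntegral_exp_smul_le {μ : Measure V} [SFinite μ] {f : V → G}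
    (hf : Integrable f μ) (ν : Measure V) [IsFiniteMeasure ν] (L : V →L[ℝ] V →L[ℝ] ℝ)
    {M : V → ℝ≥0∞} (hM : Measurable M) {κ : ℝ} (hκ : 0 ≤ κ) {A : ℝ≥0∞}
    (hν : ∀ z, ∫⁻ z', M (z - z') ∂ν ≤ ENNReal.ofReal κ * M z)
    (hA : ∀ z, ‖fourierIntegral 𝐞 μ L.toLinearMap₁₂ f z‖ₑ ≤ A * M z) (z : V) :
    ‖fourierIntegral 𝐞 μ L.toLinearMap₁₂
      (fun w => Complex.exp (pairingCharFun ν L w) • f w) z‖ₑ ≤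
      A * ENNReal.ofReal (rexp κ) * M z := by
  set K := pairingCharFun ν L with hK
  set m := ν.real Set.univ with hm
  set F : ℕ → V → G := fun n w =>
    𝐞 (-(L w z)) • ((n.factorial : ℂ)⁻¹ • (K w ^ n • f w)) with hF
  have hFc (n : ℕ) : F n = fun w => (n.factorial : ℂ)⁻¹ • (𝐞 (-(L w z)) • (K w ^ n • f w)) := by
    ext w; simp only [hF]; rw [smul_comm]
  have h_int (n : ℕ) : Integrable (F n) μ := by
    rw [hFc]
    have := (fourierIntegral_convergent_iff Real.continuous_fourierChar
      (L := L.toLinearMap₁₂) (continuous_pairing L) z).2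
      (integrable_pairingCharFun_pow_smul hf ν L n)
    exact this.smul _
  have hnorm (n : ℕ) (w : V) : ‖F n w‖ ≤ m ^ n / n.factorial * ‖f w‖ := by
    simp only [hF]
    rw [Circle.norm_smul, norm_smul, norm_smul, norm_inv, norm_pow, Complex.norm_natCast,
      div_eq_inv_mul, mul_assoc]
    gcongr
    exact norm_pairingCharFun_le ν L w
  have hsum : Summable fun n => ∫ w, ‖F n w‖ ∂μ := by
    refine Summable.of_nonneg_of_le (fun n => integral_nonneg fun w => norm_nonneg _)
      (fun n => ?_) ((Real.summable_pow_div_factorial m).mul_right (∫ w, ‖f w‖ ∂μ))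
    rw [← integral_const_mul]
    exact integral_mono (h_int n).norm (hf.norm.const_mul _) (hnorm n)
  have hs := hasSum_integral_of_summable_integral_norm h_int hsum
  have htsum (w : V) : ∑' n, F n w = 𝐞 (-(L w z)) • (Complex.exp (K w) • f w) := by
    have h1 : HasSum (fun n : ℕ => (n.factorial : ℂ)⁻¹ * K w ^ n) (Complex.exp (K w)) := by
      rw [Complex.exp_eq_exp_ℂ]
      simpa [div_eq_inv_mul] using NormedSpace.expSeries_div_hasSum_exp (K w)
    have h2 := (h1.smul_const (f w)).const_smul (𝐞 (-(L w z)))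
    simp only [mul_smul] at h2
    exact h2.tsum_eq
  have e1 : fourierIntegral 𝐞 μ L.toLinearMap₁₂ (fun w => Complex.exp (K w) • f w) z =
      ∑' n, ∫ w, F n w ∂μ := by
    rw [hs.tsum_eq]
    simp only [htsum]
    rfl
  rw [e1]
  calc _ ≤ ∑' n, ‖∫ w, F n w ∂μ‖ₑ := enorm_tsum_le_tsum_enorm
    _ ≤ ∑' n : ℕ, A * ENNReal.ofReal (κ ^ n / n.factorial) * M z := by
        refine ENNReal.tsum_le_tsum fun n => ?_
        rw [hFc, integral_smul, enorm_smul]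
        have h3 := enorm_fourierIntegral_pairingCharFun_pow_smul_le hf ν L hM hν hA n z
        have h4 : ‖(n.factorial : ℂ)⁻¹‖ₑ = ENNReal.ofReal ((n.factorial : ℝ)⁻¹) := by
          rw [← ofReal_norm, norm_inv, Complex.norm_natCast]
        rw [h4]
        calc _ ≤ ENNReal.ofReal ((n.factorial : ℝ)⁻¹) * (A * ENNReal.ofReal κ ^ n * M z) := by
              gcongr
              exact h3
          _ = _ := by
              rw [div_eq_mul_inv, ENNReal.ofReal_mul (by positivity), ENNReal.ofReal_pow hκ]
              ring
    _ = _ := by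
        rw [ENNReal.tsum_mul_right, ENNReal.tsum_mul_left, ← ENNReal.ofReal_tsum_of_nonneg
          (fun n => by positivity) (Real.summable_pow_div_factorial κ)]
        congr 3
        rw [Real.exp_eq_exp_ℝ, NormedSpace.exp_eq_tsum_div]

end FourierExp

section ParametricIntegral

open Set Filter Topology
open scoped ContDiff

variable {W F : Type*} [NormedAddCommGroup W] [NormedSpace ℝ W] [NormedAddCommGroup F]
  [NormedSpace ℝ F]

lemma continuous_iteratedFDeriv_comp_clm {h : F → ℝ} (hh : ContDiff ℝ ∞ h) {ℓ : ℝ → W →L[ℝ] F}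
    (hℓ : Continuous ℓ) (n : ℕ) (w : W) :
    Continuous fun s => iteratedFDeriv ℝ n (h ∘ ℓ s) w := by
  have e : ∀ s, iteratedFDeriv ℝ n (h ∘ ℓ s) w =
      ContinuousMultilinearMap.compContinuousLinearMapContinuousMultilinear ℝ
        (fun _ : Fin n => W) (fun _ => F) ℝ (fun _ => ℓ s) (iteratedFDeriv ℝ n h (ℓ s w)) :=
    fun s => (ℓ s).iteratedFDeriv_comp_right hh w (mod_cast le_top)
  simp only [e]
  refine Continuous.clm_apply ?_ ?_
  · exact (ContinuousMultilinearMap.cont _).comp (continuous_pi fun _ => hℓ)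
  · exact (hh.continuous_iteratedFDeriv (mod_cast le_top)).comp (hℓ.clm_apply continuous_const)

lemma norm_iteratedFDeriv_comp_clm_le {h : F → ℝ} (hh : ContDiff ℝ ∞ h) {ℓ : W →L[ℝ] F}
    (hℓ : ‖ℓ‖ ≤ 1) {n k : ℕ} {C : ℝ} (hC0 : 0 ≤ C)
    (hC : ∀ x, ‖iteratedFDeriv ℝ n h x‖ ≤ C * (1 + ‖x‖) ^ k) (w : W) :
    ‖iteratedFDeriv ℝ n (h ∘ ℓ) w‖ ≤ C * (1 + ‖w‖) ^ k := by
  rw [ℓ.iteratedFDeriv_comp_right hh w (mod_cast le_top)]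
  refine (ContinuousMultilinearMap.norm_compContinuousLinearMap_le _ _).trans ?_
  have h1 : ∏ _i : Fin n, ‖ℓ‖ ≤ 1 := by
    simpa using pow_le_one₀ (norm_nonneg ℓ) hℓ
  have h2 : ‖ℓ w‖ ≤ ‖w‖ := (ℓ.le_opNorm w).trans (mul_le_of_le_one_left (norm_nonneg w) hℓ)
  calc _ ≤ ‖iteratedFDeriv ℝ n h (ℓ w)‖ * 1 := by gcongr
    _ ≤ C * (1 + ‖ℓ w‖) ^ k := by rw [mul_one]; exact hC _
    _ ≤ _ := by gcongr

/-- Averages of a function of temperate growth along a family of contractions have temperate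
growth. -/
lemma hasTemperateGrowth_integral_comp_clm {h : F → ℝ} (hh : h.HasTemperateGrowth)
    {ℓ : ℝ → W →L[ℝ] F} (hℓ : Continuous ℓ) (hℓ1 : ∀ s ∈ Icc (0 : ℝ) 1, ‖ℓ s‖ ≤ 1) :
    Function.HasTemperateGrowth fun w => ∫ s in Icc (0 : ℝ) 1, h (ℓ s w) := by
  set p : W → FormalMultilinearSeries ℝ W ℝ := fun w n =>
    ∫ s in Icc (0 : ℝ) 1, iteratedFDeriv ℝ n (h ∘ ℓ s) w with hp
  have hsm : ∀ s, ContDiff ℝ ∞ (h ∘ ℓ s) := fun s => hh.1.comp (ℓ s).contDiff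
  have hcont := fun n w => continuous_iteratedFDeriv_comp_clm hh.1 hℓ n w
  have h_int : ∀ n w, IntegrableOn (fun s => iteratedFDeriv ℝ n (h ∘ ℓ s) w) (Icc (0 : ℝ) 1) :=
    fun n w => (hcont n w).continuousOn.integrableOn_compact isCompact_Icc
  have hbd : ∀ n, ∃ (k : ℕ) (C : ℝ), 0 ≤ C ∧ ∀ s ∈ Icc (0 : ℝ) 1, ∀ w,
      ‖iteratedFDeriv ℝ n (h ∘ ℓ s) w‖ ≤ C * (1 + ‖w‖) ^ k := by
    intro n
    obtain ⟨k, C, hC0, hC⟩ := hh.norm_iteratedFDeriv_le_uniform n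
    exact ⟨k, C, hC0, fun s hs w =>
      norm_iteratedFDeriv_comp_clm_le hh.1 (hℓ1 s hs) hC0 (hC n le_rfl) w⟩
  have hd : ∀ n w, HasFDerivAt (fun w => p w n) (p w (n + 1)).curryLeft w := by
    intro n w
    obtain ⟨k, C, hC0, hC⟩ := hbd (n + 1)
    have key := hasFDerivAt_integral_of_dominated_of_fderiv_le
      (μ := volume.restrict (Icc (0 : ℝ) 1)) (s := Metric.ball w 1) (x₀ := w) (𝕜 := ℝ)
      (F := fun w s => iteratedFDeriv ℝ n (h ∘ ℓ s) w)
      (F' := fun w s => (iteratedFDeriv ℝ (n + 1) (h ∘ ℓ s) w).curryLeft)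
      (bound := fun _ => C * (2 + ‖w‖) ^ k)
      (Metric.ball_mem_nhds w one_pos)
      (Eventually.of_forall fun w => (hcont n w).aestronglyMeasurable) (h_int n w)
      ((continuousMultilinearCurryLeftEquiv ℝ (fun _ : Fin (n + 1) => W) ℝ).continuous.comp
        (hcont (n + 1) w)).aestronglyMeasurable
      ((ae_restrict_iff' measurableSet_Icc).2 (Eventually.of_forall fun s hs w' hw' => by
        rw [ContinuousMultilinearMap.curryLeft_norm]
        refine (hC s hs w').trans ?_
        have h1 : ‖w'‖ ≤ ‖w‖ + 1 := by
          have h2 := norm_le_norm_add_norm_sub' w' w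
          have h3 := mem_ball_iff_norm.1 hw'
          linarith
        have h4 : 1 + ‖w'‖ ≤ 2 + ‖w‖ := by linarith
        exact mul_le_mul_of_nonneg_left (pow_le_pow_left₀ (by positivity) h4 k) hC0))
      (integrable_const _)
      (Eventually.of_forall fun s w' _ => by
        have h1 := ((hsm s).differentiable_iteratedFDeriv (m := n)
          (mod_cast ENat.natCast_lt_top n) w').hasFDerivAt
        rw [fderiv_iteratedFDeriv] at h1
        exact h1)
    let Λ : (W [×(n + 1)]→L[ℝ] ℝ) →L[ℝ] (W →L[ℝ] (W [×n]→L[ℝ] ℝ)) :=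
      (continuousMultilinearCurryLeftEquiv ℝ (fun _ : Fin (n + 1) => W)
        ℝ).toContinuousLinearEquiv.toContinuousLinearMap
    have e : (p w (n + 1)).curryLeft = ∫ s in Icc (0 : ℝ) 1,
        (iteratedFDeriv ℝ (n + 1) (h ∘ ℓ s) w).curryLeft :=
      (ContinuousLinearMap.integral_comp_comm (𝕜 := ℝ) (E := W [×(n + 1)]→L[ℝ] ℝ)
      (Fₗ := W →L[ℝ] (W [×n]→L[ℝ] ℝ)) Λ (h_int (n + 1) w)).symm
    rw [e]
    exact key
  have hT : HasFTaylorSeriesUpTo ∞ (fun w => ∫ s in Icc (0 : ℝ) 1, h (ℓ s w)) p := by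
    refine ⟨fun w => ?_, fun m _ w => hd m w, fun m _ => ?_⟩
    · have := ((continuousMultilinearCurryFin0 ℝ W
        ℝ).toContinuousLinearEquiv.integral_comp_comm
        (μ := volume.restrict (Icc (0 : ℝ) 1)) (fun s => iteratedFDeriv ℝ 0 (h ∘ ℓ s) w))
      refine Eq.trans this.symm ?_
      rfl
    · exact continuous_iff_continuousAt.2 fun w => (hd m w).continuousAt
  refine ⟨hT.contDiff, fun n => ?_⟩
  obtain ⟨k, C, hC0, hC⟩ := hbd n
  refine ⟨k, C, fun w => ?_⟩
  have e : iteratedFDeriv ℝ n (fun w => ∫ s in Icc (0 : ℝ) 1, h (ℓ s w)) w = p w n :=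
    (hT.eq_iteratedFDeriv (mod_cast le_top) w).symm
  rw [e]
  refine (norm_setIntegral_le_of_norm_le_const (C := C * (1 + ‖w‖) ^ k) (by simp)
    fun s hs => hC s hs w).trans (by simp)

end ParametricIntegral

section StretchedExp

open scoped ContDiff SchwartzMap

lemma exists_pow_mul_exp_neg_rpow_le {c α : ℝ} (hc : 0 < c) (hα : 0 < α) (k : ℕ) :
    ∃ C, 0 ≤ C ∧ ∀ x : ℝ, 0 ≤ x → (1 + x) ^ k * rexp (-(c * x ^ α)) ≤ C := by
  set n := ⌈(k : ℝ) / α⌉₊ with hn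
  refine ⟨2 ^ k * max 1 (n.factorial / c ^ n), by positivity, fun x hx => ?_⟩
  rcases le_total x 1 with h1 | h1
  · have h2 : (1 + x) ^ k ≤ 2 ^ k := by gcongr; linarith
    have h3 : rexp (-(c * x ^ α)) ≤ 1 := Real.exp_le_one_iff.2 (by
      have : 0 ≤ c * x ^ α := by positivity
      linarith)
    exact mul_le_mul h2 (h3.trans (le_max_left _ _)) (by positivity) (by positivity)
  · have h2 : (1 + x) ^ k ≤ 2 ^ k * x ^ k := by rw [← mul_pow]; gcongr; linarith
    have h3 : x ^ k ≤ (x ^ α) ^ n := by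
      rw [← Real.rpow_natCast, ← Real.rpow_natCast, ← Real.rpow_mul hx]
      refine Real.rpow_le_rpow_of_exponent_le h1 ?_
      have := Nat.le_ceil ((k : ℝ) / α)
      rw [div_le_iff₀ hα] at this
      linarith
    have h4 := Real.pow_div_factorial_le_exp (x := c * x ^ α) (by positivity) n
    have h5 : x ^ k * rexp (-(c * x ^ α)) ≤ n.factorial / c ^ n := by
      rw [Real.exp_neg, ← div_eq_mul_inv, div_le_iff₀ (Real.exp_pos _)]
      refine h3.trans ?_
      rw [mul_pow] at h4
      calc (x ^ α) ^ n = n.factorial / c ^ n * (c ^ n * (x ^ α) ^ n / n.factorial) := by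
            field_simp
        _ ≤ _ := by gcongr
    calc _ ≤ 2 ^ k * x ^ k * rexp (-(c * x ^ α)) := by gcongr
      _ = 2 ^ k * (x ^ k * rexp (-(c * x ^ α))) := by ring
      _ ≤ _ := by gcongr; exact h5.trans (le_max_right _ _)

variable {W : Type*} [NormedAddCommGroup W] [NormedSpace ℝ W]

/-- The exponential of minus a function of temperate growth bounded below by a power of the norm
is a Schwartz function. -/
lemma exists_schwartzMap_exp_neg {f : W → ℝ} (hf : f.HasTemperateGrowth) {c α : ℝ} (hc : 0 < c)
    (hα : 0 < α) (hlow : ∀ w, c * ‖w‖ ^ α ≤ f w) :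
    ∃ φ : 𝓢(W, ℂ), ∀ w, φ w = (rexp (-f w) : ℂ) := by
  have hsm : ContDiff ℝ ∞ fun w => rexp (-f w) := Real.contDiff_exp.comp hf.1.neg
  refine ⟨⟨fun w => (rexp (-f w) : ℂ), Complex.ofRealCLM.contDiff.comp hsm, fun k n => ?_⟩,
    fun w => rfl⟩
  obtain ⟨m, C, hC0, hC⟩ := hf.neg.norm_iteratedFDeriv_le_uniform n
  obtain ⟨A, hA0, hA⟩ := exists_pow_mul_exp_neg_rpow_le hc hα (k + m * n)
  refine ⟨n.factorial * (1 + C) ^ n * A, fun w => ?_⟩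
  have e1 : ‖iteratedFDeriv ℝ n (fun w => (rexp (-f w) : ℂ)) w‖ =
      ‖iteratedFDeriv ℝ n (fun w => rexp (-f w)) w‖ :=
    Complex.ofRealLI.norm_iteratedFDeriv_comp_left (n := ∞) hsm.contDiffAt (mod_cast le_top)
  have e2 : ‖iteratedFDeriv ℝ n (fun w => rexp (-f w)) w‖ ≤
      n.factorial * rexp (-f w) * ((1 + C) * (1 + ‖w‖) ^ m) ^ n := by
    refine norm_iteratedFDeriv_comp_le (N := ∞) (g := rexp) (f := -f) Real.contDiff_exp hf.1.neg
      (mod_cast le_top) w (fun i _ => ?_) (fun i hi hin => ?_)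
    · rw [norm_iteratedFDeriv_eq_norm_iteratedDeriv, iteratedDeriv_eq_iterate, Real.iter_deriv_exp]
      simp
    · have h1 : 1 ≤ (1 + ‖w‖) ^ m := one_le_pow₀ (by linarith [norm_nonneg w])
      refine (hC i hin w).trans ?_
      calc C * (1 + ‖w‖) ^ m ≤ (1 + C) * (1 + ‖w‖) ^ m := by gcongr; linarith
        _ ≤ _ := le_self_pow₀ (by nlinarith) (by lia)
  have e3 : rexp (-f w) ≤ rexp (-(c * ‖w‖ ^ α)) := by gcongr; exact hlow w
  rw [e1]
  calc ‖w‖ ^ k * ‖iteratedFDeriv ℝ n (fun w => rexp (-f w)) w‖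
      ≤ (1 + ‖w‖) ^ k * (n.factorial * rexp (-(c * ‖w‖ ^ α)) *
          ((1 + C) * (1 + ‖w‖) ^ m) ^ n) := by
        gcongr
        · linarith
        · exact e2.trans (by gcongr)
    _ = n.factorial * (1 + C) ^ n * ((1 + ‖w‖) ^ (k + m * n) * rexp (-(c * ‖w‖ ^ α))) := by
        rw [mul_pow, ← pow_mul, pow_add]; ring
    _ ≤ _ := by gcongr; exact hA _ (norm_nonneg w)

end StretchedExp

section FourierDecay

open scoped FourierTransform SchwartzMap ContDiff
open VectorFourier

variable {V : Type*} [NormedAddCommGroup V] [NormedSpace ℝ V] [FiniteDimensional ℝ V]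
  [MeasurableSpace V] [BorelSpace V]

lemma integrable_fourierSMulRight {μ : Measure V} (L : V →L[ℝ] V →L[ℝ] ℝ) {f : V → ℂ}
    (hf : Integrable f μ) (hf' : Integrable (fun v => ‖v‖ * ‖f v‖) μ) :
    Integrable (fourierSMulRight L f) μ := by
  refine (hf'.const_mul (2 * π * ‖L‖)).mono' (hf.aestronglyMeasurable.fourierSMulRight (L := L))
    (Filter.Eventually.of_forall fun w => ?_)
  exact (norm_fourierSMulRight_le L f w).trans_eq (by ring)

/-- The derivative of the Fourier integral of a Schwartz function with respect to a coercive
pairing decays faster than any power. -/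
lemma exists_norm_fderiv_fourierIntegral_le {μ : Measure V} [μ.IsAddHaarMeasure]
    (L : V →L[ℝ] V →L[ℝ] ℝ) {c : ℝ} (hc : 0 < c) (hL : ∀ z, c * ‖z‖ ^ 2 ≤ L z z) (φ : 𝓢(V, ℂ))
    (β : ℝ) :
    ∃ C, 0 ≤ C ∧ ∀ z, ‖fderiv ℝ (fourierIntegral 𝐞 μ L.toLinearMap₁₂ φ) z‖ ≤
      C * polyWeight β z := by
  set g := fourierIntegral 𝐞 μ L.toLinearMap₁₂ φ
  have key : ∀ n : ℕ, ∃ A, 0 ≤ A ∧ ∀ z, ‖z‖ ^ n * ‖fderiv ℝ g z‖ ≤ A := by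
    intro n
    obtain ⟨A, hA0, hA⟩ : ∃ A, 0 ≤ A ∧ ∀ z, |L z z| ^ n * ‖iteratedFDeriv ℝ 1 g z‖ ≤ ‖z‖ ^ n * A :=
      by
      refine ⟨(2 * π * ‖L‖) ^ 1 * (2 * (1 : ℕ) + 2) ^ n *
        ∑ p ∈ Finset.range (1 + 1) ×ˢ Finset.range (n + 1),
          ∫ v, ‖v‖ ^ p.1 * ‖iteratedFDeriv ℝ p.2 φ v‖ ∂μ, by positivity, fun z => ?_⟩
      have := pow_mul_norm_iteratedFDeriv_fourierIntegral_le (μ := μ) (K := ⊤) (N := ⊤) L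
        (φ.smooth ⊤) (fun k n _ _ => φ.integrable_pow_mul_iteratedFDeriv μ k n)
        (k := 1) (n := n) le_top le_top z z
      simpa only [mul_assoc] using this
    refine ⟨A / c ^ n, by positivity, fun z => ?_⟩
    have hz := hA z
    rw [norm_iteratedFDeriv_one] at hz
    rcases (pow_nonneg (norm_nonneg z) n).eq_or_lt with h0 | h0
    · rw [← h0, zero_mul]; positivity
    · rw [le_div_iff₀ (by positivity)]
      refine le_of_mul_le_mul_left ?_ h0
      calc ‖z‖ ^ n * (‖z‖ ^ n * ‖fderiv ℝ g z‖ * c ^ n)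
          = (c * ‖z‖ ^ 2) ^ n * ‖fderiv ℝ g z‖ := by rw [mul_pow, ← pow_mul]; ring
        _ ≤ |L z z| ^ n * ‖fderiv ℝ g z‖ := by gcongr; exact (hL z).trans (le_abs_self _)
        _ ≤ _ := hz
  obtain ⟨A, hA0, hA⟩ := key 0
  set n := ⌈β⌉₊
  obtain ⟨B, hB0, hB⟩ := key n
  refine ⟨2 ^ (n - 1) * (A + B), by positivity, fun z => ?_⟩
  have h1 : 1 ≤ 1 + ‖z‖ := by linarith [norm_nonneg z]
  have h2 : (1 + ‖z‖) ^ n * ‖fderiv ℝ g z‖ ≤ 2 ^ (n - 1) * (A + B) := by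
    calc _ ≤ 2 ^ (n - 1) * (1 ^ n + ‖z‖ ^ n) * ‖fderiv ℝ g z‖ := by
          gcongr; exact add_pow_le zero_le_one (norm_nonneg z) n
      _ = 2 ^ (n - 1) * (‖z‖ ^ 0 * ‖fderiv ℝ g z‖ + ‖z‖ ^ n * ‖fderiv ℝ g z‖) := by
          rw [one_pow, pow_zero]; ring
      _ ≤ _ := by gcongr; exacts [hA z, hB z]
  have h3 : (1 + ‖z‖) ^ β ≤ (1 + ‖z‖) ^ n := by
    rw [← Real.rpow_natCast]
    exact Real.rpow_le_rpow_of_exponent_le h1 (Nat.le_ceil β)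
  rw [polyWeight, Real.rpow_neg (by positivity), ← div_eq_mul_inv, le_div_iff₀ (by positivity),
    mul_comm]
  exact (mul_le_mul_of_nonneg_right h3 (norm_nonneg _)).trans h2

end FourierDecay

section KineticSymbol

open Set Module
open scoped ENNReal FourierTransform SchwartzMap ContDiff
open VectorFourier

variable {E : Type*} [NormedAddCommGroup E] [InnerProductSpace ℝ E]

/-- The kinetic symbol `∫₀¹ ‖s ξ + η‖ ^ α ds`. -/
noncomputable def kinSymbol (α : ℝ) (w : E × E) : ℝ :=
  ∫ s in Icc (0 : ℝ) 1, ‖s • w.1 + w.2‖ ^ α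

/-- The smooth kinetic symbol `∫₀¹ (1 + ‖s ξ + η‖ ^ 2) ^ (α / 2) ds`. -/
noncomputable def kinBesselSymbol (α : ℝ) (w : E × E) : ℝ :=
  ∫ s in Icc (0 : ℝ) 1, (1 + ‖s • w.1 + w.2‖ ^ 2) ^ (α / 2)

lemma continuous_norm_smul_add_rpow {α : ℝ} (hα : 0 ≤ α) (w : E × E) :
    Continuous fun s : ℝ => ‖s • w.1 + w.2‖ ^ α :=
  (by fun_prop : Continuous fun s : ℝ => ‖s • w.1 + w.2‖).rpow_const fun _ => Or.inr hα

lemma continuous_one_add_norm_sq_smul_add_rpow (α : ℝ) (w : E × E) :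
    Continuous fun s : ℝ => (1 + ‖s • w.1 + w.2‖ ^ 2) ^ (α / 2) :=
  (by fun_prop : Continuous fun s : ℝ => 1 + ‖s • w.1 + w.2‖ ^ 2).rpow_const
    fun _ => Or.inl (by positivity)

lemma kinSymbol_le_kinBesselSymbol {α : ℝ} (hα : 0 ≤ α) (w : E × E) :
    kinSymbol α w ≤ kinBesselSymbol α w := by
  refine setIntegral_mono_on
    (continuous_norm_smul_add_rpow hα w).continuousOn.integrableOn_Icc
    (continuous_one_add_norm_sq_smul_add_rpow α w).continuousOn.integrableOn_Icc measurableSet_Icc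
    fun s _ => ?_
  have h : ‖s • w.1 + w.2‖ ^ α = (‖s • w.1 + w.2‖ ^ 2) ^ (α / 2) := by
    rw [← Real.rpow_natCast, ← Real.rpow_mul (norm_nonneg _)]
    congr 1; push_cast; ring
  rw [h]
  exact Real.rpow_le_rpow (by positivity) (by linarith) (by positivity)

lemma norm_rpow_le_rpow_add_rpow {α : ℝ} (hα : 0 ≤ α) (w : E × E) {s : ℝ}
    (hs : s ∈ Icc (0 : ℝ) (1 / 3)) :
    (‖w‖ / 3) ^ α ≤ ‖s • w.1 + w.2‖ ^ α + ‖(s + 2 / 3) • w.1 + w.2‖ ^ α := by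
  obtain ⟨hs0, hs1⟩ := hs
  set a := s • w.1 + w.2 with ha
  set b := (s + 2 / 3) • w.1 + w.2 with hb
  have h1 : (2 / 3 : ℝ) * ‖w.1‖ ≤ ‖a‖ + ‖b‖ := by
    have e : (2 / 3 : ℝ) • w.1 = b - a := by rw [ha, hb]; module
    have := norm_sub_le b a
    rw [← e, norm_smul, Real.norm_of_nonneg (by norm_num)] at this
    linarith
  have h2 : (2 / 3 : ℝ) * ‖w.2‖ ≤ ‖a‖ + ‖b‖ := by
    have e : (2 / 3 : ℝ) • w.2 = (s + 2 / 3) • a - s • b := by rw [ha, hb]; module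
    have := norm_sub_le ((s + 2 / 3) • a) (s • b)
    rw [← e, norm_smul, norm_smul, norm_smul, Real.norm_of_nonneg (by norm_num),
      Real.norm_of_nonneg hs0, Real.norm_of_nonneg (by linarith : 0 ≤ s + 2 / 3)] at this
    nlinarith [norm_nonneg a, norm_nonneg b]
  have h3 : (2 / 3 : ℝ) * ‖w‖ ≤ ‖a‖ + ‖b‖ := by
    rcases max_choice ‖w.1‖ ‖w.2‖ with h | h <;> rw [Prod.norm_def, h] <;> assumption
  have h4 : ‖w‖ / 3 ≤ max ‖a‖ ‖b‖ := by
    linarith [le_max_left ‖a‖ ‖b‖, le_max_right ‖a‖ ‖b‖]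
  have h5 := Real.rpow_le_rpow (by positivity) h4 hα
  have h6 : 0 ≤ ‖a‖ ^ α := by positivity
  have h7 : 0 ≤ ‖b‖ ^ α := by positivity
  rcases max_choice ‖a‖ ‖b‖ with h | h <;> rw [h] at h5 <;> linarith

lemma le_kinSymbol {α : ℝ} (hα : 0 ≤ α) (w : E × E) :
    1 / 3 * (1 / 3) ^ α * ‖w‖ ^ α ≤ kinSymbol α w := by
  set f : ℝ → ℝ := fun s => ‖s • w.1 + w.2‖ ^ α with hf
  have hc : Continuous f := continuous_norm_smul_add_rpow hα w
  have hi : ∀ a b, IntervalIntegrable f volume a b := fun a b => hc.intervalIntegrable a b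
  have h0 : ∀ s, 0 ≤ f s := fun s => by positivity
  have e1 : kinSymbol α w = ∫ s in (0 : ℝ)..1, f s := by
    rw [kinSymbol, integral_Icc_eq_integral_Ioc, intervalIntegral.integral_of_le zero_le_one]
  have e2 : (∫ s in (0 : ℝ)..1, f s) = (∫ s in (0 : ℝ)..(1 / 3), f s) +
      (∫ s in (1 / 3 : ℝ)..(2 / 3), f s) + ∫ s in (2 / 3 : ℝ)..1, f s := by
    rw [intervalIntegral.integral_add_adjacent_intervals (hi _ _) (hi _ _),
      intervalIntegral.integral_add_adjacent_intervals (hi _ _) (hi _ _)]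
  have e3 : (∫ s in (2 / 3 : ℝ)..1, f s) = ∫ s in (0 : ℝ)..(1 / 3), f (s + 2 / 3) := by
    rw [intervalIntegral.integral_comp_add_right]; norm_num
  have h1 : 0 ≤ ∫ s in (1 / 3 : ℝ)..(2 / 3), f s :=
    intervalIntegral.integral_nonneg (by norm_num) fun s _ => h0 s
  have h2 : (∫ s in (0 : ℝ)..(1 / 3), (‖w‖ / 3) ^ α) ≤
      ∫ s in (0 : ℝ)..(1 / 3), (f s + f (s + 2 / 3)) :=
    intervalIntegral.integral_mono_on (by norm_num) (by simp)
      ((hi _ _).add ((by fun_prop : Continuous fun s => f (s + 2 / 3)).intervalIntegrable _ _))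
      fun s hs => norm_rpow_le_rpow_add_rpow hα w hs
  rw [intervalIntegral.integral_add (hi _ _)
    ((by fun_prop : Continuous fun s => f (s + 2 / 3)).intervalIntegrable _ _),
    intervalIntegral.integral_const, smul_eq_mul] at h2
  have e4 : (‖w‖ / 3) ^ α = (1 / 3) ^ α * ‖w‖ ^ α := by
    rw [← Real.mul_rpow (by norm_num) (norm_nonneg _)]; ring_nf
  rw [e1, e2, e3]
  rw [e4] at h2
  linarith

lemma hasTemperateGrowth_kinBesselSymbol (α : ℝ) :
    Function.HasTemperateGrowth (kinBesselSymbol α : E × E → ℝ) := by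
  have h1 : Function.HasTemperateGrowth fun x : E => (1 + ‖(2 : ℝ) • x‖ ^ 2) ^ (α / 2) :=
    (Function.hasTemperateGrowth_one_add_norm_sq_rpow E (α / 2)).comp
      ((2 : ℝ) • ContinuousLinearMap.id ℝ E).hasTemperateGrowth
  have h2 := hasTemperateGrowth_integral_comp_clm h1 (ℓ := fun s : ℝ => (2⁻¹ : ℝ) •
    (s • ContinuousLinearMap.fst ℝ E E + ContinuousLinearMap.snd ℝ E E)) (by fun_prop) ?_
  · convert h2 using 2 with w
    refine integral_congr_ae (Filter.Eventually.of_forall fun s => ?_)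
    simp [smul_smul]
  · intro s hs
    refine ContinuousLinearMap.opNorm_le_bound _ zero_le_one fun w => ?_
    have h3 := norm_add_le (s • w.1) w.2
    rw [norm_smul, Real.norm_of_nonneg hs.1] at h3
    have h4 := norm_fst_le w
    have h5 := norm_snd_le w
    change ‖(2⁻¹ : ℝ) • (s • w.1 + w.2)‖ ≤ _
    rw [norm_smul, Real.norm_of_nonneg (by norm_num)]
    nlinarith [hs.1, hs.2, norm_nonneg w.1]

variable (E) in
/-- The Euclidean pairing on `E × E`, normalized by `1 / (2 π)`. -/
noncomputable def phasePairing : (E × E) →L[ℝ] (E × E) →L[ℝ] ℝ :=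
  (2 * π)⁻¹ • ((innerSL ℝ).bilinearComp (ContinuousLinearMap.fst ℝ E E)
      (ContinuousLinearMap.fst ℝ E E) +
    (innerSL ℝ).bilinearComp (ContinuousLinearMap.snd ℝ E E) (ContinuousLinearMap.snd ℝ E E))

lemma phasePairing_apply (w z : E × E) :
    phasePairing E w z = (2 * π)⁻¹ * (⟪w.1, z.1⟫ + ⟪w.2, z.2⟫) := by
  simp [phasePairing, mul_add]

lemma le_phasePairing_self (z : E × E) : (2 * π)⁻¹ * ‖z‖ ^ 2 ≤ phasePairing E z z := by
  rw [phasePairing_apply, real_inner_self_eq_norm_sq, real_inner_self_eq_norm_sq]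
  gcongr
  have h1 := sq_nonneg ‖z.1‖
  have h2 := sq_nonneg ‖z.2‖
  rcases max_choice ‖z.1‖ ‖z.2‖ with h | h <;> rw [Prod.norm_def, h] <;> linarith

lemma fourierChar_phasePairing (w z : E × E) :
    (𝐞 (phasePairing E w z) : ℂ) = Complex.exp (Complex.I * (⟪w.1, z.1⟫ + ⟪w.2, z.2⟫ : ℝ)) := by
  rw [Real.fourierChar_apply, phasePairing_apply]
  congr 1
  have : (π : ℂ) ≠ 0 := by exact_mod_cast Real.pi_ne_zero
  push_cast
  field_simp

variable [FiniteDimensional ℝ E]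

lemma continuous_kinSymbol {α : ℝ} (hα : 0 ≤ α) : Continuous (kinSymbol α : E × E → ℝ) := by
  have h : Continuous fun p : (E × E) × ℝ => ‖p.2 • p.1.1 + p.1.2‖ ^ α :=
    (by fun_prop : Continuous fun p : (E × E) × ℝ => ‖p.2 • p.1.1 + p.1.2‖).rpow_const
      fun _ => Or.inr hα
  exact continuous_parametric_integral_of_continuous h isCompact_Icc

variable [MeasurableSpace E] [BorelSpace E]

/-- The kinetic jump measure has characteristic function the average of that of its density along
the kinetic trajectories. -/
lemma pairingCharFun_kinJumpMeasure {k : E → ℝ} (hk : Measurable k) (hk0 : ∀ y, 0 ≤ k y)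
    (hki : Integrable k) (w : E × E) :
    pairingCharFun (kinJumpMeasure fun y => ENNReal.ofReal (k y)) (phasePairing E) w =
      ∫ s in Icc (0 : ℝ) 1, ∫ y, Complex.exp (Complex.I * ⟪y, s • w.1 + w.2⟫) * (k y : ℂ) := by
  have hfin : ∫⁻ y, ENNReal.ofReal (k y) ≠ ⊤ := hki.lintegral_lt_top.ne
  have := isFiniteMeasure_withDensity hfin
  have hc : Continuous fun z : E × E => (𝐞 (phasePairing E w z) : ℂ) := by
    simp only [fourierChar_phasePairing]; fun_prop
  rw [pairingCharFun, kinJumpMeasure, integral_map (by fun_prop) hc.aestronglyMeasurable,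
    integral_prod]
  · refine integral_congr_ae (Filter.Eventually.of_forall fun s => ?_)
    simp only
    rw [integral_withDensity_eq_integral_toReal_smul (by fun_prop)
      (Filter.Eventually.of_forall fun _ => ENNReal.ofReal_lt_top)]
    refine integral_congr_ae (Filter.Eventually.of_forall fun y => ?_)
    simp only [fourierChar_phasePairing, ENNReal.toReal_ofReal (hk0 y), Complex.real_smul,
      inner_add_right, inner_smul_right]
    rw [mul_comm, real_inner_comm, real_inner_comm w.2]
  · refine Integrable.of_bound (C := 1) ?_ (Filter.Eventually.of_forall fun p => (Circle.norm_coe _).le)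
    exact (hc.comp (by fun_prop : Continuous fun p : ℝ × E => (p.1 • p.2, p.2))).aestronglyMeasurable

/-- The kinetic symbol differs from its smooth version by the characteristic function of a finite
jump measure which acts boundedly on the kinetic majorant. -/
lemma exists_jumpMeasure_kinSymbol (hE : finrank ℝ E ≠ 0) {α : ℝ} (hα : α ∈ Ioo (0 : ℝ) 2) :
    ∃ ν : Measure (E × E), IsFiniteMeasure ν ∧
      (∀ w, pairingCharFun ν (phasePairing E) w = (kinBesselSymbol α w - kinSymbol α w : ℝ)) ∧
      ∃ κ : ℝ, 0 ≤ κ ∧ ∀ z, ∫⁻ z', kinMajorant (finrank ℝ E + α) (z - z') ∂ν ≤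
        ENNReal.ofReal κ * kinMajorant (finrank ℝ E + α) z := by
  obtain ⟨k, hk, hk0, hki, ⟨A, hA0, hA⟩, hkF⟩ := exists_kernel_fourier_eq (E := E) hα
  have hfin : ∫⁻ y, ENNReal.ofReal (k y) ≠ ⊤ := hki.lintegral_lt_top.ne
  refine ⟨kinJumpMeasure fun y => ENNReal.ofReal (k y), isFiniteMeasure_kinJumpMeasure hfin,
    fun w => ?_, ?_⟩
  · rw [pairingCharFun_kinJumpMeasure hk hk0 hki]
    simp only [hkF]
    rw [integral_complex_ofReal, integral_sub
      (continuous_one_add_norm_sq_smul_add_rpow α w).continuousOn.integrableOn_Icc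
      (continuous_norm_smul_add_rpow hα.1.le w).continuousOn.integrableOn_Icc]
    rfl
  · have h1 := lintegral_kinMajorant_sub_le (β := finrank ℝ E + α) hE (by linarith [hα.1])
      hk.ennreal_ofReal hfin (A := ENNReal.ofReal A) fun y hy => by
        rw [ePolyWeight, ← ENNReal.ofReal_mul hA0]
        exact ENNReal.ofReal_le_ofReal (hA y hy)
    have h2 := (lintegral_ePolyWeight_lt_top (E := E) (β := finrank ℝ E + α)
      (by linarith [hα.1])).ne
    obtain ⟨c, hc, h3⟩ : ∃ c : ℝ≥0∞, c ≠ ⊤ ∧ ∀ z, ∫⁻ z', kinMajorant (finrank ℝ E + α) (z - z')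
        ∂(kinJumpMeasure fun y => ENNReal.ofReal (k y)) ≤ c * kinMajorant (finrank ℝ E + α) z :=
      ⟨_, by finiteness, h1⟩
    refine ⟨c.toReal, ENNReal.toReal_nonneg, fun z => (h3 z).trans_eq ?_⟩
    rw [ENNReal.ofReal_toReal hc]

end KineticSymbol

section UnitTimeKernel

open Set Module
open scoped ENNReal FourierTransform SchwartzMap ContDiff
open VectorFourier

variable {E : Type*} [NormedAddCommGroup E] [InnerProductSpace ℝ E] [FiniteDimensional ℝ E]
  [MeasurableSpace E] [BorelSpace E]

instance isAddHaarMeasure_volume_prod_self :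
    (volume : Measure (E × E)).IsAddHaarMeasure :=
  inferInstanceAs ((volume.prod volume : Measure (E × E)).IsAddHaarMeasure)

/-- The unit time kinetic kernel, up to normalization and as a complex-valued function. -/
noncomputable def kinKernel (α : ℝ) : E × E → ℂ :=
  fourierIntegral 𝐞 volume (phasePairing E).toLinearMap₁₂ fun w => (rexp (-kinSymbol α w) : ℂ)

lemma exists_schwartzMap_kinBesselSymbol {α : ℝ} (hα : 0 < α) :
    ∃ φ : 𝓢(E × E, ℂ), ∀ w, φ w = (rexp (-kinBesselSymbol α w) : ℂ) :=
  exists_schwartzMap_exp_neg (hasTemperateGrowth_kinBesselSymbol α)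
    (c := 1 / 3 * (1 / 3) ^ α) (by positivity) hα
    fun w => (le_kinSymbol hα.le w).trans (kinSymbol_le_kinBesselSymbol hα.le w)

lemma integrable_pow_mul_exp_neg_kinSymbol {α : ℝ} (hα : 0 < α) (n : ℕ) :
    Integrable fun w : E × E => ‖w‖ ^ n * ‖(rexp (-kinSymbol α w) : ℂ)‖ := by
  obtain ⟨C, hC0, hC⟩ := exists_pow_mul_exp_neg_rpow_le (c := 1 / 3 * (1 / 3) ^ α)
    (by positivity) hα (n + (finrank ℝ (E × E) + 1))
  have hc := continuous_kinSymbol (E := E) hα.le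
  have h1 : Integrable fun w : E × E => C * (1 + ‖w‖) ^ (-((finrank ℝ (E × E) : ℝ) + 1)) :=
    (integrable_one_add_norm (by linarith)).const_mul C
  refine h1.mono' (by fun_prop) (Filter.Eventually.of_forall fun w => ?_)
  rw [Real.norm_of_nonneg (by positivity), Complex.norm_real, Real.norm_of_nonneg (by positivity),
    Real.rpow_neg (by positivity), ← div_eq_mul_inv, le_div_iff₀ (by positivity)]
  have h2 : (1 + ‖w‖) ^ ((finrank ℝ (E × E) : ℝ) + 1) = (1 + ‖w‖) ^ (finrank ℝ (E × E) + 1) := by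
    exact_mod_cast Real.rpow_natCast (1 + ‖w‖) (finrank ℝ (E × E) + 1)
  rw [h2]
  calc _ ≤ (1 + ‖w‖) ^ n * rexp (-(1 / 3 * (1 / 3) ^ α * ‖w‖ ^ α)) *
        (1 + ‖w‖) ^ (finrank ℝ (E × E) + 1) := by
        gcongr
        · linarith
        · exact le_kinSymbol hα.le w
    _ = (1 + ‖w‖) ^ (n + (finrank ℝ (E × E) + 1)) *
        rexp (-(1 / 3 * (1 / 3) ^ α * ‖w‖ ^ α)) := by rw [pow_add]; ring
    _ ≤ C := hC _ (norm_nonneg w)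

lemma integrable_exp_neg_kinSymbol {α : ℝ} (hα : 0 < α) :
    Integrable fun w : E × E => (rexp (-kinSymbol α w) : ℂ) := by
  have hc := continuous_kinSymbol (E := E) hα.le
  have h := integrable_pow_mul_exp_neg_kinSymbol (E := E) hα 0
  simp only [pow_zero, one_mul] at h
  exact (integrable_norm_iff (by fun_prop)).1 h

lemma contDiff_kinKernel {α : ℝ} (hα : 0 < α) : ContDiff ℝ 1 (kinKernel α : E × E → ℂ) :=
  contDiff_fourierIntegral (N := 1) _ fun n _ => integrable_pow_mul_exp_neg_kinSymbol hα n

/-- The derivative of the unit time kinetic kernel is bounded by the kinetic majorant. -/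
lemma exists_enorm_fderiv_kinKernel_le (hE : finrank ℝ E ≠ 0) {α : ℝ} (hα : α ∈ Ioo (0 : ℝ) 2) :
    ∃ C : ℝ, 0 ≤ C ∧ ∀ z : E × E, ‖fderiv ℝ (kinKernel α) z‖ₑ ≤
      ENNReal.ofReal C * kinMajorant (finrank ℝ E + α) z := by
  obtain ⟨ν, hν, hK, κ, hκ0, hκ⟩ := exists_jumpMeasure_kinSymbol hE hα
  obtain ⟨φ, hφ⟩ := exists_schwartzMap_kinBesselSymbol (E := E) hα.1
  set β := (finrank ℝ E + α : ℝ) with hβ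
  have hβ0 : 0 ≤ β := by have := hα.1; positivity
  set L := phasePairing E with hL
  obtain ⟨A, hA0, hA⟩ := exists_norm_fderiv_fourierIntegral_le (μ := (volume : Measure (E × E))) L
    (c := (2 * π)⁻¹) (by positivity) le_phasePairing_self φ (2 * β)
  have hφ1 : Integrable (fun v => ‖v‖ * ‖φ v‖) (volume : Measure (E × E)) := by
    simpa using φ.integrable_pow_mul (volume : Measure (E × E)) 1
  have hD0 : fderiv ℝ (fourierIntegral 𝐞 volume L.toLinearMap₁₂ φ) =
      fourierIntegral 𝐞 volume L.toLinearMap₁₂ (fourierSMulRight L φ) :=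
    fderiv_fourierIntegral L φ.integrable hφ1
  have hD : fderiv ℝ (kinKernel α) =
      fourierIntegral 𝐞 volume L.toLinearMap₁₂
        fun w => Complex.exp (pairingCharFun ν L w) • fourierSMulRight L φ w := by
    rw [kinKernel, fderiv_fourierIntegral L (integrable_exp_neg_kinSymbol hα.1)
      (by simpa using integrable_pow_mul_exp_neg_kinSymbol (E := E) hα.1 1)]
    congr 1
    ext w : 1
    have e : (rexp (-kinSymbol α w) : ℂ) = Complex.exp (pairingCharFun ν L w) * φ w := by
      rw [hK, hφ]
      push_cast
      rw [← Complex.exp_add]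
      ring_nf
    refine ContinuousLinearMap.ext fun z => ?_
    rw [fourierSMulRight_apply, _root_.smul_apply, fourierSMulRight_apply, e]
    simp only [smul_eq_mul, Complex.real_smul]
    ring
  have h_int : Integrable (fourierSMulRight L φ) (volume : Measure (E × E)) :=
    integrable_fourierSMulRight L φ.integrable hφ1
  refine ⟨A * 2 ^ β * rexp κ, by positivity, fun z => ?_⟩
  rw [hD]
  refine (enorm_fourierIntegral_exp_smul_le (A := ENNReal.ofReal (A * 2 ^ β)) h_int ν L
    (measurable_kinMajorant β) hκ0 hκ (fun z => ?_) z).trans_eq ?_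
  · rw [← hD0, ENNReal.ofReal_mul hA0, mul_assoc]
    refine le_trans ?_ (mul_le_mul_right (ePolyWeight_two_mul_le_kinMajorant hβ0 z) _)
    rw [ePolyWeight, ← ENNReal.ofReal_mul hA0, ← ofReal_norm]
    exact ENNReal.ofReal_le_ofReal (hA z)
  · rw [← ENNReal.ofReal_mul (by positivity)]

lemma sqrt_sq_add_sq_le_two_mul_norm (z : E × E) : √(‖z.1‖ ^ 2 + ‖z.2‖ ^ 2) ≤ 2 * ‖z‖ := by
  rw [Real.sqrt_le_iff]
  have h1 := norm_fst_le z
  have h2 := norm_snd_le z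
  exact ⟨by positivity, by nlinarith [norm_nonneg z.1, norm_nonneg z.2]⟩

lemma polyWeight_mul_inv_le {β : ℝ} (hβ : 0 ≤ β) (z : E × E) :
    polyWeight β z * (1 + ‖z‖)⁻¹ ≤
      2 ^ (1 + β) * (1 + √(‖z.1‖ ^ 2 + ‖z.2‖ ^ 2)) ^ (-(1 + β)) := by
  have h := sqrt_sq_add_sq_le_two_mul_norm z
  have e : polyWeight β z * (1 + ‖z‖)⁻¹ = ((1 + ‖z‖) ^ (1 + β))⁻¹ := by
    rw [polyWeight, ← Real.rpow_neg_one, ← Real.rpow_add (by positivity),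
      ← Real.rpow_neg (by positivity)]
    ring_nf
  rw [e, Real.rpow_neg (by positivity), ← div_eq_mul_inv, le_div_iff₀ (by positivity),
    inv_mul_le_iff₀ (by positivity), ← Real.mul_rpow (by positivity) (by norm_num)]
  gcongr
  linarith

/-- The kinetic majorant is bounded by the explicit kinetic profile. -/
lemma exists_kinMajorant_le {β : ℝ} (hβ : 1 < β) :
    ∃ C : ℝ, 0 ≤ C ∧ ∀ z : E × E, kinMajorant β z ≤
      ENNReal.ofReal (C * ((1 + √(‖z.1‖ ^ 2 + ‖z.2‖ ^ 2)) ^ (-(1 + β)) *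
        (1 + ⨅ s : Icc (0 : ℝ) 1, ‖z.1 - (s : ℝ) • z.2‖) ^ (1 - β))) := by
  have hI : 0 ≤ ∫ r : ℝ, polyWeight β r := integral_nonneg fun r => (polyWeight_pos β r).le
  refine ⟨3 * (1 + 2 ^ β * ∫ r : ℝ, polyWeight β r) * 2 ^ (1 + β), by positivity, fun z => ?_⟩
  set D := ⨅ s : Icc (0 : ℝ) 1, ‖z.1 - (s : ℝ) • z.2‖ with hD
  have hD0 : 0 ≤ D := Real.iInf_nonneg fun s => norm_nonneg _
  have hDle : ∀ r ∈ Icc (0 : ℝ) 1, D ≤ ‖z.1 - r • z.2‖ := fun r hr =>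
    ciInf_le (f := fun s : Icc (0 : ℝ) 1 => ‖z.1 - (s : ℝ) • z.2‖)
      ⟨0, by rintro _ ⟨s, rfl⟩; exact norm_nonneg _⟩ ⟨r, hr⟩
  rw [kinMajorant]
  refine (mul_le_mul_right (lintegral_ePolyWeight_sub_smul_le hβ z.1 z.2 hD0 hDle) _).trans ?_
  rw [ePolyWeight, ← ENNReal.ofReal_mul (polyWeight_pos β z).le]
  refine ENNReal.ofReal_le_ofReal ?_
  have h := polyWeight_mul_inv_le (by linarith : 0 ≤ β) z
  calc _ = 3 * (1 + 2 ^ β * ∫ r : ℝ, polyWeight β r) * (1 + D) ^ (1 - β) *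
        (polyWeight β z * (1 + ‖z‖)⁻¹) := by ring
    _ ≤ 3 * (1 + 2 ^ β * ∫ r : ℝ, polyWeight β r) * (1 + D) ^ (1 - β) *
        (2 ^ (1 + β) * (1 + √(‖z.1‖ ^ 2 + ‖z.2‖ ^ 2)) ^ (-(1 + β))) := by gcongr
    _ = _ := by ring

lemma exists_norm_fderiv_kinKernel_le (hE : 1 ≤ finrank ℝ E) {α : ℝ} (hα : α ∈ Ioo (0 : ℝ) 2) :
    ∃ C : ℝ, 0 ≤ C ∧ ∀ z : E × E, ‖fderiv ℝ (kinKernel α) z‖ ≤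
      C * ((1 + √(‖z.1‖ ^ 2 + ‖z.2‖ ^ 2)) ^ (-(1 + (finrank ℝ E + α))) *
        (1 + ⨅ s : Icc (0 : ℝ) 1, ‖z.1 - (s : ℝ) • z.2‖) ^ (1 - (finrank ℝ E + α))) := by
  obtain ⟨C, hC0, hC⟩ := exists_enorm_fderiv_kinKernel_le (by lia : finrank ℝ E ≠ 0) hα
  have h1 : (1 : ℝ) ≤ finrank ℝ E := by exact_mod_cast hE
  obtain ⟨C', hC0', hC'⟩ := exists_kinMajorant_le (E := E) (β := finrank ℝ E + α)
    (by linarith [hα.1])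
  refine ⟨C * C', by positivity, fun z => ?_⟩
  have hD0 : 0 ≤ ⨅ s : Icc (0 : ℝ) 1, ‖z.1 - (s : ℝ) • z.2‖ :=
    Real.iInf_nonneg fun s => norm_nonneg _
  rw [mul_assoc, ← ENNReal.ofReal_le_ofReal_iff (by positivity), ENNReal.ofReal_mul hC0]
  exact (ofReal_norm (fderiv ℝ (kinKernel α) z)).trans_le
    ((hC z).trans (mul_le_mul_right (hC' z) _))

end UnitTimeKernel

section KineticScaling

open Set Module
open scoped FourierTransform
open VectorFourier

section General

variable {E : Type*} [NormedAddCommGroup E] [InnerProductSpace ℝ E]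

lemma intervalIntegral_norm_rpow_eq_kinSymbol {α t : ℝ} (hα : 0 < α) (ht : 0 < t) (w : E × E) :
    (∫ s in (0 : ℝ)..t, ‖s • (t ^ (-α⁻¹ - 1)) • w.1 + (t ^ (-α⁻¹)) • w.2‖ ^ α) =
      kinSymbol α w := by
  have h1 := intervalIntegral.smul_integral_comp_mul_left (a := 0) (b := 1)
    (fun s => ‖s • (t ^ (-α⁻¹ - 1)) • w.1 + (t ^ (-α⁻¹)) • w.2‖ ^ α) t
  rw [mul_zero, mul_one] at h1
  rw [← h1, smul_eq_mul, ← intervalIntegral.integral_const_mul, kinSymbol,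
    integral_Icc_eq_integral_Ioc, intervalIntegral.integral_of_le zero_le_one]
  refine integral_congr_ae (Filter.Eventually.of_forall fun s => ?_)
  have h2 : t * t ^ (-α⁻¹ - 1) = t ^ (-α⁻¹) := by
    rw [Real.rpow_sub_one ht.ne']; field_simp
  have h3 : (t * s) • (t ^ (-α⁻¹ - 1)) • w.1 + (t ^ (-α⁻¹)) • w.2 =
      (t ^ (-α⁻¹)) • (s • w.1 + w.2) := by
    rw [smul_add, smul_smul, smul_smul, ← h2]; ring_nf
  have h4 : (t ^ (-α⁻¹)) ^ α = t⁻¹ := by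
    rw [← Real.rpow_mul ht.le, neg_mul, inv_mul_cancel₀ hα.ne', Real.rpow_neg_one]
  simp only
  rw [h3, norm_smul, Real.norm_of_nonneg (by positivity), Real.mul_rpow (by positivity)
    (norm_nonneg _), h4, mul_inv_cancel_left₀ ht.ne']

variable [FiniteDimensional ℝ E] [MeasurableSpace E] [BorelSpace E]

lemma integral_prod_eq_mul_integral_comp_smul {a b : ℝ} (ha : 0 < a) (hb : 0 < b)
    (g : E × E → ℝ) :
    ∫ w, g w = a ^ finrank ℝ E * b ^ finrank ℝ E * ∫ w : E × E, g (a • w.1, b • w.2) := by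
  have hmap : Measure.map (Prod.map (fun x : E => a • x) fun x : E => b • x)
      (volume : Measure (E × E)) =
      (ENNReal.ofReal |(a ^ finrank ℝ E)⁻¹| * ENNReal.ofReal |(b ^ finrank ℝ E)⁻¹|) •
        (volume : Measure (E × E)) := by
    rw [Measure.volume_eq_prod, ← Measure.map_prod_map _ _ (by fun_prop) (by fun_prop),
      Measure.map_addHaar_smul _ ha.ne', Measure.map_addHaar_smul _ hb.ne',
      Measure.prod_smul_left, Measure.prod_smul_right, smul_smul]
  have hemb : MeasurableEmbedding (Prod.map (fun x : E => a • x) fun x : E => b • x) :=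
    ((Homeomorph.smulOfNeZero a ha.ne').prodCongr
      (Homeomorph.smulOfNeZero b hb.ne')).measurableEmbedding
  have h := hemb.integral_map (μ := volume) g
  rw [hmap, integral_smul_measure, ENNReal.toReal_mul, ENNReal.toReal_ofReal (abs_nonneg _),
    ENNReal.toReal_ofReal (abs_nonneg _), abs_of_pos (by positivity), abs_of_pos (by positivity),
    smul_eq_mul] at h
  change _ = _ * ∫ w, g (Prod.map (fun x : E => a • x) (fun x : E => b • x) w)
  rw [← h]
  field_simp

lemma re_kinKernel {α : ℝ} (hα : 0 < α) (z : E × E) :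
    (kinKernel α z).re =
      ∫ w : E × E, Real.cos (⟪z.1, w.1⟫ + ⟪z.2, w.2⟫) * rexp (-kinSymbol α w) := by
  have h_int : Integrable fun w : E × E =>
      𝐞 (-(phasePairing E w z)) • (rexp (-kinSymbol α w) : ℂ) :=
    (VectorFourier.fourierIntegral_convergent_iff (L := (phasePairing E).toLinearMap₁₂)
      Real.continuous_fourierChar (continuous_pairing (phasePairing E)) z).2
      (integrable_exp_neg_kinSymbol hα)
  change RCLike.re (∫ w : E × E, 𝐞 (-(phasePairing E w z)) • (rexp (-kinSymbol α w) : ℂ)) = _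
  rw [← integral_re h_int]
  refine integral_congr_ae (Filter.Eventually.of_forall fun w => ?_)
  simp only
  have e : -(phasePairing E w z) = phasePairing E (-w) z := by simp
  rw [e, Circle.smul_def, fourierChar_phasePairing, smul_eq_mul]
  simp only [RCLike.re_to_complex]
  rw [Complex.re_mul_ofReal, mul_comm Complex.I, Complex.exp_ofReal_mul_I_re]
  congr 1
  rw [← Real.cos_neg, real_inner_comm w.1, real_inner_comm w.2]
  congr 1
  simp [add_comm]

end General

lemma kinHeat_eq {d : ℕ} {α t : ℝ} (hα : 0 < α) (ht : 0 < t) (x v : EuclideanSpace ℝ (Fin d)) :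
    kinHeat d α t x v = (2 * π) ^ (-(2 * (d : ℝ))) *
      ((t ^ (-α⁻¹ - 1)) ^ d * (t ^ (-α⁻¹)) ^ d) *
        (kinKernel α ((t ^ (-α⁻¹ - 1)) • x, (t ^ (-α⁻¹)) • v)).re := by
  rw [kinHeat, integral_prod_eq_mul_integral_comp_smul (a := t ^ (-α⁻¹ - 1)) (b := t ^ (-α⁻¹))
    (by positivity) (by positivity), finrank_euclideanSpace_fin, re_kinKernel hα]
  simp only [intervalIntegral_norm_rpow_eq_kinSymbol hα ht, inner_smul_left, inner_smul_right,
    conj_trivial]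
  ring

lemma norm_fderiv_const_mul_re_comp_le {F V : Type*} [NormedAddCommGroup F] [NormedSpace ℝ F]
    [NormedAddCommGroup V] [NormedSpace ℝ V] {f : V → ℂ} (hf : Differentiable ℝ f) {c r : ℝ}
    (hc : 0 ≤ c) (A : F →L[ℝ] V) (hA : ‖A‖ ≤ r) (b : V) (x : F) :
    ‖fderiv ℝ (fun x' => c * (f (A x' + b)).re) x‖ ≤ c * r * ‖fderiv ℝ f (A x + b)‖ := by
  have h1 : HasFDerivAt (fun x' => A x' + b) A x := A.hasFDerivAt.add_const b
  have h2 := (((Complex.reCLM.hasFDerivAt).comp x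
    ((hf (A x + b)).hasFDerivAt.comp x h1)).const_mul c).fderiv
  have h3 : ‖c • (Complex.reCLM ∘L ((fderiv ℝ f (A x + b)) ∘L A))‖ ≤
      c * r * ‖fderiv ℝ f (A x + b)‖ := by
    rw [norm_smul, Real.norm_of_nonneg hc, mul_assoc]
    gcongr
    refine (ContinuousLinearMap.opNorm_comp_le _ _).trans ?_
    rw [Complex.reCLM_norm, one_mul]
    refine (ContinuousLinearMap.opNorm_comp_le _ _).trans ?_
    rw [mul_comm]
    gcongr
  refine le_trans (le_of_eq ?_) h3
  exact congrArg _ h2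

lemma kinN_nonneg (d : ℕ) (β : ℝ) (x v : EuclideanSpace ℝ (Fin d)) : 0 ≤ kinN d β x v := by
  have : 0 ≤ ⨅ s : Set.Icc (0 : ℝ) 1, ‖x - (s : ℝ) • v‖ := Real.iInf_nonneg fun s => norm_nonneg _
  unfold kinN
  positivity

end KineticScaling

/-- the kinetic heat kernel is `C¹` and its spatial and velocity gradients
satisfy sharp upper bounds. -/
theorem stmt_3 (d : ℕ) (hd : 1 ≤ d) (α : ℝ) (hα : α ∈ Set.Ioo (0 : ℝ) 2) :
    (∀ t > (0 : ℝ),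
      ContDiff ℝ 1 (fun z : EuclideanSpace ℝ (Fin d) × EuclideanSpace ℝ (Fin d) =>
        kinHeat d α t z.1 z.2)) ∧
    ∃ C > (0 : ℝ), ∀ t > (0 : ℝ), ∀ x v : EuclideanSpace ℝ (Fin d),
      ‖fderiv ℝ (fun x' => kinHeat d α t x' v) x‖ ≤
          C * t ^ (-(2 * (d : ℝ) + 1) / α - 1 - d) *
            kinN d ((d : ℝ) + α) ((t ^ (-α⁻¹ - 1)) • x) ((t ^ (-α⁻¹)) • v) ∧
      ‖fderiv ℝ (fun v' => kinHeat d α t x v') v‖ ≤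
          C * t ^ (-(2 * (d : ℝ) + 1) / α - d) *
            kinN d ((d : ℝ) + α) ((t ^ (-α⁻¹ - 1)) • x) ((t ^ (-α⁻¹)) • v) := by
  set E := EuclideanSpace ℝ (Fin d) with hE
  have hα0 := hα.1
  have hdiff : ContDiff ℝ 1 (kinKernel α : E × E → ℂ) := contDiff_kinKernel hα0
  refine ⟨fun t ht => ?_, ?_⟩
  · simp only [kinHeat_eq hα0 ht]
    refine contDiff_const.mul (Complex.reCLM.contDiff.comp (hdiff.comp ?_))
    fun_prop
  obtain ⟨C, hC0, hC⟩ := exists_norm_fderiv_kinKernel_le (E := E)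
    (by rw [finrank_euclideanSpace_fin]; exact hd) hα
  rw [finrank_euclideanSpace_fin] at hC
  set c₀ : ℝ := (2 * π) ^ (-(2 * (d : ℝ)))
  have hc₀ : 0 < c₀ := by positivity
  refine ⟨c₀ * (C + 1), by positivity, fun t ht x v => ?_⟩
  set a := t ^ (-α⁻¹ - 1) with ha
  set b := t ^ (-α⁻¹) with hb
  have ha0 : 0 < a := by positivity
  have hb0 : 0 < b := by positivity
  have hN : ‖fderiv ℝ (kinKernel α) (a • x, b • v)‖ ≤ (C + 1) * kinN d (d + α) (a • x) (b • v) := by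
    refine (hC (a • x, b • v)).trans ?_
    have := kinN_nonneg d (d + α) (a • x) (b • v)
    change C * kinN d (d + α) (a • x) (b • v) ≤ _
    linarith
  have hpow : a ^ d * b ^ d = t ^ ((-α⁻¹ - 1) * d + (-α⁻¹) * d) := by
    rw [Real.rpow_add ht, Real.rpow_mul ht.le, Real.rpow_mul ht.le, Real.rpow_natCast,
      Real.rpow_natCast]
  have hx : a ^ d * b ^ d * a = t ^ (-(2 * (d : ℝ) + 1) / α - 1 - d) := by
    rw [hpow, ha, ← Real.rpow_add ht]
    congr 1
    field_simp
    ring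
  have hv : a ^ d * b ^ d * b = t ^ (-(2 * (d : ℝ) + 1) / α - d) := by
    rw [hpow, hb, ← Real.rpow_add ht]
    congr 1
    field_simp
    ring
  constructor
  · have h1 := norm_fderiv_const_mul_re_comp_le (hdiff.differentiable one_ne_zero)
      (c := c₀ * (a ^ d * b ^ d)) (r := a) (by positivity)
      (a • ContinuousLinearMap.inl ℝ E E) ?_ (0, b • v) x
    · have e : (fun x' => kinHeat d α t x' v) = fun x' => c₀ * (a ^ d * b ^ d) *
          (kinKernel α ((a • ContinuousLinearMap.inl ℝ E E) x' + (0, b • v))).re := by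
        ext x'
        rw [kinHeat_eq hα0 ht]
        simp [c₀, ← ha, ← hb]
      have e2 : (a • ContinuousLinearMap.inl ℝ E E) x + (0, b • v) = (a • x, b • v) := by simp
      rw [e2] at h1
      rw [e, ← hx]
      calc _ ≤ c₀ * (a ^ d * b ^ d) * a * ‖fderiv ℝ (kinKernel α) (a • x, b • v)‖ := h1
        _ ≤ c₀ * (a ^ d * b ^ d) * a * ((C + 1) * kinN d (d + α) (a • x) (b • v)) := by gcongr
        _ = _ := by ring
    · refine ContinuousLinearMap.opNorm_le_bound _ ha0.le fun y => ?_
      simp [norm_smul, abs_of_pos ha0, mul_nonneg ha0.le (norm_nonneg y)]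
  · have h1 := norm_fderiv_const_mul_re_comp_le (hdiff.differentiable one_ne_zero)
      (c := c₀ * (a ^ d * b ^ d)) (r := b) (by positivity)
      (b • ContinuousLinearMap.inr ℝ E E) ?_ (a • x, 0) v
    · have e : (fun v' => kinHeat d α t x v') = fun v' => c₀ * (a ^ d * b ^ d) *
          (kinKernel α ((b • ContinuousLinearMap.inr ℝ E E) v' + (a • x, 0))).re := by
        ext v'
        rw [kinHeat_eq hα0 ht]
        simp [c₀, ← ha, ← hb]
      have e2 : (b • ContinuousLinearMap.inr ℝ E E) v + (a • x, 0) = (a • x, b • v) := by simp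
      rw [e2] at h1
      rw [e, ← hv]
      calc _ ≤ c₀ * (a ^ d * b ^ d) * b * ‖fderiv ℝ (kinKernel α) (a • x, b • v)‖ := h1
        _ ≤ c₀ * (a ^ d * b ^ d) * b * ((C + 1) * kinN d (d + α) (a • x) (b • v)) := by gcongr
        _ = _ := by ring
    · refine ContinuousLinearMap.opNorm_le_bound _ hb0.le fun y => ?_
      simp [norm_smul, abs_of_pos hb0, mul_nonneg hb0.le (norm_nonneg y)]
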